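/- arXiv:1603.08361 — 5 statements merged into one kernel-verified Lean document; each statement's English description precedes it below -/
import Mathlib

section
/- Let m ≥ 1 and r ≥ 1. The family of 2r-multilinear forms (φ_M), indexed by the perfect matchings M of {1,…,2r}, is linearly independent in the space of 2r-multilinear forms on ℂ^m if and only if r ≤ m. (This is the orthogonal-group case, n = 0, of the paper's criterion that the kernel of the invariant map on (2r,0)-Brauer diagrams is nonzero exactly when r ≥ (m+1)(n+1).) -/
open scoped BigOperators

/-- A perfect matching of `{0,…,N-1}`, encoded as a fixed-point-free involution:
the two-element blocks of the matching are the orbits `{i, σ i}`. -/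
abbrev PM (N : ℕ) := {σ : Equiv.Perm (Fin N) // (∀ i, σ (σ i) = i) ∧ ∀ i, σ i ≠ i}

/-- The standard symmetric bilinear form `⟨u,v⟩ = Σ_a u_a v_a` on `ℂ^m`. -/
noncomputable def dotC (m : ℕ) (u w : Fin m → ℂ) : ℂ := ∑ a, u a * w a

/-- The `2r`-multilinear form `φ_M(v) = ∏_{{i,j}∈M} ⟨v_i, v_j⟩` on `ℂ^m`
attached to a perfect matching `M`. -/
noncomputable def phiO (m r : ℕ) (M : PM (2*r)) : (Fin (2*r) → Fin m → ℂ) → ℂ :=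
  fun v => ∏ i ∈ Finset.univ.filter (fun i : Fin (2*r) => i < M.1 i), dotC m (v i) (v (M.1 i))

/-- A perfect matching of `{0,…,2r-1}` has exactly `r` blocks. -/
lemma card_lt_matching (r : ℕ) (M : PM (2 * r)) :
    Fintype.card {i : Fin (2 * r) // i < M.1 i} = r := by
  obtain ⟨σ, hinv, hne⟩ := M
  rw [Fintype.card_subtype]
  have hflip : (Finset.univ.filter fun i => i < σ i).card =
      (Finset.univ.filter fun i => ¬ i < σ i).card := by
    refine Finset.card_bij (fun i _ => σ i) ?_ (fun i _ j _ h => σ.injective h) ?_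
    · intro i hi
      simp only [Finset.mem_filter, Finset.mem_univ, true_and, hinv, not_lt] at hi ⊢
      exact hi.le
    · intro j hj
      simp only [Finset.mem_filter, Finset.mem_univ, true_and, not_lt] at hj
      refine ⟨σ j, ?_, hinv j⟩
      simp only [Finset.mem_filter, Finset.mem_univ, true_and, hinv]
      exact lt_of_le_of_ne hj (hne j)
  have hsum := Finset.card_filter_add_card_filter_not
    (s := (Finset.univ : Finset (Fin (2 * r)))) (fun i => i < σ i)
  rw [Finset.card_univ, Fintype.card_fin] at hsum
  simp only at hflip ⊢
  omega

/-- If `r ≤ m`, the points can be coloured with `m` colours so that two points share a colour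
exactly when they lie in the same block. -/
lemma exists_block_coloring {m r : ℕ} (h : r ≤ m) (M : PM (2 * r)) :
    ∃ c : Fin (2 * r) → Fin m, ∀ i j, c i = c j ↔ j = i ∨ j = M.1 i := by
  obtain ⟨f⟩ : Nonempty ({i : Fin (2 * r) // i < M.1 i} ↪ Fin m) := by
    apply Function.Embedding.nonempty_of_card_le
    rw [card_lt_matching, Fintype.card_fin]
    exact h
  obtain ⟨σ, hinv, hne⟩ := M
  have hlt : ∀ i, ¬ i < σ i → σ i < σ (σ i) := fun i hi => by
    rw [hinv]
    exact lt_of_le_of_ne (not_lt.1 hi) (hne i)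
  refine ⟨fun i => if hi : i < σ i then f ⟨i, hi⟩ else f ⟨σ i, hlt i hi⟩, fun i j => ?_⟩
  have hswap : ∀ a b, σ a = b ↔ a = σ b := fun a b =>
    ⟨fun hab => by rw [← hab, hinv], fun hab => by rw [hab, hinv]⟩
  by_cases hi : i < σ i <;> by_cases hj : j < σ j <;>
    simp only [hi, hj, dite_true, dite_false, f.injective.eq_iff, Subtype.mk.injEq]
  · refine ⟨fun hij => Or.inl hij.symm, ?_⟩
    rintro (rfl | rfl)
    · rfl
    · rw [hinv] at hj
      exact absurd hj hi.asymm
  · refine ⟨fun hij => Or.inr ((hswap i j).2 hij).symm, ?_⟩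
    rintro (rfl | rfl)
    · exact absurd hi hj
    · exact (hinv i).symm
  · refine ⟨fun hij => Or.inr hij.symm, ?_⟩
    rintro (rfl | rfl)
    · exact absurd hj hi
    · rfl
  · refine ⟨fun hij => Or.inl (σ.injective hij).symm, ?_⟩
    rintro (rfl | rfl)
    · rfl
    · exact absurd (hlt i hi) hj

lemma dotC_single (m : ℕ) (a b : Fin m) :
    dotC m (Pi.single a 1) (Pi.single b 1) = if a = b then 1 else 0 := by
  simp [dotC, Pi.single_apply, eq_comm]

lemma linearIndependent_phiO {m r : ℕ} (h : r ≤ m) : LinearIndependent ℂ (phiO m r) := by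
  rw [Fintype.linearIndependent_iff]
  intro g hg M
  obtain ⟨c, hc⟩ := exists_block_coloring h M
  have hval := congrFun hg (fun i => Pi.single (c i) 1)
  simp only [Finset.sum_apply, Pi.smul_apply, smul_eq_mul, Pi.zero_apply, phiO, dotC_single]
    at hval
  rw [Finset.sum_eq_single M] at hval
  · rwa [Finset.prod_eq_one, mul_one] at hval
    intro i _
    exact if_pos ((hc _ _).2 (Or.inr rfl))
  · intro N _ hNM
    refine mul_eq_zero_of_right _ ?_
    by_contra hprod
    refine hNM (Subtype.ext (Equiv.ext fun i => ?_))
    have hsame : ∀ i, i < N.1 i → N.1 i = M.1 i := by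
      intro i hi
      have hfac := Finset.prod_ne_zero_iff.1 hprod i (by simpa using hi)
      exact ((hc _ _).1 (of_not_not fun hne => hfac (if_neg hne))).resolve_left (N.2.2 i)
    rcases lt_or_gt_of_ne (N.2.2 i) with hlt | hlt
    · have hfix := hsame (N.1 i) (by rwa [N.2.1])
      rw [N.2.1] at hfix
      rw [← M.2.1 (N.1 i), ← hfix]
    · exact hsame i hlt
  · simp

/-- The identification of `{0,…,2r-1}` with two copies of `{0,…,r-1}`, the first copy
coming before the second. -/
def halves (r : ℕ) : Fin r ⊕ Fin r ≃ Fin (2 * r) :=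
  finSumFinEquiv.trans (finCongr (two_mul r).symm)

lemma halves_inl_lt_inr {r : ℕ} (i j : Fin r) : halves r (Sum.inl i) < halves r (Sum.inr j) := by
  simp only [halves, Equiv.trans_apply, finSumFinEquiv_apply_left, finSumFinEquiv_apply_right,
    finCongr_apply, Fin.lt_def, Fin.val_cast, Fin.val_castAdd, Fin.val_natAdd]
  omega

/-- The matching joining the `i`-th point of the first half to the `σ i`-th point of the
second half. -/
def bipartiteMatching (r : ℕ) (σ : Equiv.Perm (Fin r)) : PM (2 * r) :=
  ⟨(halves r).permCongr ((Equiv.sumCongr σ σ.symm).trans (Equiv.sumComm _ _)), by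
    constructor <;> intro k <;> obtain ⟨i | i, rfl⟩ := (halves r).surjective k <;>
      simp [Equiv.permCongr_apply]⟩

lemma bipartiteMatching_inl {r : ℕ} (σ : Equiv.Perm (Fin r)) (i : Fin r) :
    (bipartiteMatching r σ).1 (halves r (Sum.inl i)) = halves r (Sum.inr (σ i)) := by
  simp [bipartiteMatching, Equiv.permCongr_apply]

lemma bipartiteMatching_inr {r : ℕ} (σ : Equiv.Perm (Fin r)) (i : Fin r) :
    (bipartiteMatching r σ).1 (halves r (Sum.inr i)) = halves r (Sum.inl (σ.symm i)) := by
  simp [bipartiteMatching, Equiv.permCongr_apply]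

lemma bipartiteMatching_injective (r : ℕ) : Function.Injective (bipartiteMatching r) := by
  intro σ τ h
  ext1 i
  have hi := congrArg (fun M : PM (2 * r) => M.1 (halves r (Sum.inl i))) h
  simpa [bipartiteMatching_inl] using hi

lemma phiO_bipartiteMatching (m r : ℕ) (σ : Equiv.Perm (Fin r))
    (v : Fin (2 * r) → Fin m → ℂ) :
    phiO m r (bipartiteMatching r σ) v =
      ∏ i, dotC m (v (halves r (Sum.inl i))) (v (halves r (Sum.inr (σ i)))) := by
  rw [phiO, Finset.prod_filter, ← (halves r).prod_comp, Fintype.prod_sum_type]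
  simp [bipartiteMatching_inl, bipartiteMatching_inr, halves_inl_lt_inr,
    (halves_inl_lt_inr _ _).not_gt]

/-- A pairing matrix of more than `m` vectors of `ℂ^m` is singular. -/
lemma det_dotC_eq_zero {m r : ℕ} (h : m < r) (u w : Fin r → Fin m → ℂ) :
    (Matrix.of fun i j => dotC m (u i) (w j)).det = 0 := by
  have hmul : (Matrix.of fun i j => dotC m (u i) (w j)) =
      Matrix.of u * (Matrix.of w).transpose := by
    ext i j
    simp [dotC, Matrix.mul_apply]
  by_contra hdet
  have hrank := Matrix.rank_of_isUnit _ ((Matrix.isUnit_iff_isUnit_det _).2 (Ne.isUnit hdet))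
  have hle := (Matrix.rank_mul_le_left (Matrix.of u) (Matrix.of w).transpose).trans
    (Matrix.rank_le_width _)
  rw [← hmul, hrank, Fintype.card_fin] at hle
  omega

lemma sum_sign_smul_phiO {m r : ℕ} (h : m < r) :
    ∑ σ : Equiv.Perm (Fin r),
      ((Equiv.Perm.sign σ : ℤ) : ℂ) • phiO m r (bipartiteMatching r σ) = 0 := by
  ext v
  have hdet := det_dotC_eq_zero h (fun i => v (halves r (Sum.inl i)))
    (fun j => v (halves r (Sum.inr j)))
  rw [← Matrix.det_transpose, Matrix.det_apply'] at hdet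
  simpa [phiO_bipartiteMatching] using hdet

/-- For `m ≥ 1`, `r ≥ 1`, the family of `2r`-multilinear forms `φ_M`,
indexed by the perfect matchings `M` of `{1,…,2r}`, is linearly independent (in the space of
`2r`-multilinear forms on `ℂ^m`, equivalently in the space of all functions) iff `r ≤ m`. -/
theorem stmt0 (m r : ℕ) (hm : 1 ≤ m) (hr : 1 ≤ r) :
    LinearIndependent ℂ (phiO m r) ↔ r ≤ m := by
  refine ⟨fun hli => ?_, linearIndependent_phiO⟩
  by_contra hlt
  have hcomp := hli.comp _ (bipartiteMatching_injective r)
  have hone := Fintype.linearIndependent_iff.1 hcomp _ (sum_sign_smul_phiO (not_le.1 hlt)) 1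
  simp at hone
end

section
/- Let n ≥ 1 and r ≥ 1. The family of 2r-multilinear forms (φ_M), indexed by the perfect matchings M of {1,…,2r}, is linearly independent in the space of 2r-multilinear forms on ℂ^{2n} if and only if r ≤ n. (This is the symplectic-group case, m = 0, of the paper's criterion that the kernel of the invariant map on (2r,0)-Brauer diagrams is nonzero exactly when r ≥ (m+1)(n+1).) -/
open scoped BigOperators

/-- The standard symplectic form `ω(u,v) = Σ_{a=1}^n (u_a v_{n+a} - u_{n+a} v_a)` on `ℂ^{2n}`. -/
noncomputable def sympC (n : ℕ) (u w : Fin (2*n) → ℂ) : ℂ :=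
  ∑ a : Fin n,
    (u ⟨a.val, by have := a.isLt; omega⟩ * w ⟨n + a.val, by have := a.isLt; omega⟩
     - u ⟨n + a.val, by have := a.isLt; omega⟩ * w ⟨a.val, by have := a.isLt; omega⟩)

/-- The `2r`-multilinear form `φ_M(v) = ∏_{{i,j}∈M, i<j} ω(v_i, v_j)` on `ℂ^{2n}`
attached to a perfect matching `M`. -/
noncomputable def phiS (n r : ℕ) (M : PM (2*r)) : (Fin (2*r) → Fin (2*n) → ℂ) → ℂ :=
  fun v => ∏ i ∈ Finset.univ.filter (fun i : Fin (2*r) => i < M.1 i), sympC n (v i) (v (M.1 i))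

theorem sympC_add_left (n : ℕ) (u u' w : Fin (2*n) → ℂ) :
    sympC n (u + u') w = sympC n u w + sympC n u' w := by
  simp only [sympC, ← Finset.sum_add_distrib, Pi.add_apply]
  exact Finset.sum_congr rfl fun _ _ => by ring

theorem sympC_smul_left (n : ℕ) (c : ℂ) (u w : Fin (2*n) → ℂ) :
    sympC n (c • u) w = c * sympC n u w := by
  simp only [sympC, Finset.mul_sum, Pi.smul_apply, smul_eq_mul]
  exact Finset.sum_congr rfl fun _ _ => by ring

theorem sympC_swap (n : ℕ) (u w : Fin (2*n) → ℂ) : sympC n u w = -sympC n w u := by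
  simp only [sympC, ← Finset.sum_neg_distrib]
  exact Finset.sum_congr rfl fun _ _ => by ring

theorem sympC_add_right (n : ℕ) (u w w' : Fin (2*n) → ℂ) :
    sympC n u (w + w') = sympC n u w + sympC n u w' := by
  rw [sympC_swap, sympC_add_left, sympC_swap n w, sympC_swap n w']
  ring

theorem sympC_smul_right (n : ℕ) (c : ℂ) (u w : Fin (2*n) → ℂ) :
    sympC n u (c • w) = c * sympC n u w := by
  rw [sympC_swap, sympC_smul_left, sympC_swap n w]
  ring

/-- The basis vectors `e_a` (for `false`) and `f_a` (for `true`) of the standard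
symplectic basis. -/
noncomputable def sympBasis (n : ℕ) (a : Fin n) (b : Bool) : Fin (2*n) → ℂ :=
  fun j => if j.val = (if b then n + a.val else a.val) then 1 else 0

theorem sympC_basis_false_true (n : ℕ) (a c : Fin n) :
    sympC n (sympBasis n a false) (sympBasis n c true) = if a = c then 1 else 0 := by
  have h : ∀ x : Fin n, n + x.val ≠ a.val := fun x => by omega
  simp only [sympC, sympBasis, h, Fin.val_inj, Bool.false_eq_true, if_true, if_false,
    add_right_inj, zero_mul, sub_zero, ite_mul, one_mul]
  simp

theorem sympC_basis_same (n : ℕ) (a c : Fin n) (b : Bool) :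
    sympC n (sympBasis n a b) (sympBasis n c b) = 0 := by
  have h : ∀ x y : Fin n, n + x.val ≠ y.val := fun x y => by omega
  have h' : ∀ x y : Fin n, x.val ≠ n + y.val := fun x y => by omega
  cases b <;> simp [sympC, sympBasis, h, h']

theorem PM.card_openers {r : ℕ} (M : PM (2*r)) :
    (Finset.univ.filter (fun i : Fin (2*r) => i < M.1 i)).card = r := by
  have h1 : (Finset.univ.filter (fun i : Fin (2*r) => i < M.1 i)).card =
      (Finset.univ.filter (fun i : Fin (2*r) => ¬ i < M.1 i)).card := by
    refine Finset.card_bij' (fun i _ => M.1 i) (fun i _ => M.1 i) ?_ ?_ ?_ ?_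
    · intro i hi
      simp only [Finset.mem_filter, Finset.mem_univ, true_and] at hi ⊢
      rw [M.2.1]
      exact hi.not_gt
    · intro i hi
      simp only [Finset.mem_filter, Finset.mem_univ, true_and] at hi ⊢
      rw [M.2.1]
      exact lt_of_le_of_ne (not_lt.1 hi) (M.2.2 i)
    · exact fun i _ => M.2.1 i
    · exact fun i _ => M.2.1 i
  have h2 := Finset.card_filter_add_card_filter_not (s := Finset.univ)
    (fun i : Fin (2*r) => i < M.1 i)
  rw [Finset.card_univ, Fintype.card_fin] at h2
  omega

/-- If `r ≤ n`, each matching `M` has a dual point: a tuple of vectors on which `φ_M` is `1`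
and every other `φ_M'` vanishes. -/
theorem exists_phiS_dual {n r : ℕ} (h : r ≤ n) (M : PM (2*r)) :
    ∃ v : Fin (2*r) → Fin (2*n) → ℂ, ∀ M' : PM (2*r),
      phiS n r M' v = if M' = M then 1 else 0 := by
  classical
  set S := Finset.univ.filter (fun i : Fin (2*r) => i < M.1 i) with hS
  have hmem : ∀ i, i ∈ S ↔ i < M.1 i := fun i => by simp [hS]
  have hmem' : ∀ i, i ∉ S → M.1 i ∈ S := fun i hi => by
    rw [hmem] at hi ⊢
    rw [M.2.1]
    exact lt_of_le_of_ne (not_lt.1 hi) (M.2.2 i)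
  obtain ⟨a⟩ : Nonempty (S ↪ Fin n) := Function.Embedding.nonempty_of_card_le (by
    rwa [Fintype.card_coe, hS, PM.card_openers M, Fintype.card_fin])
  let v : Fin (2*r) → Fin (2*n) → ℂ := fun i =>
    if hi : i ∈ S then sympBasis n (a ⟨i, hi⟩) false
    else sympBasis n (a ⟨M.1 i, hmem' i hi⟩) true
  have hne : ∀ i j, M.1 i ≠ j → sympC n (v i) (v j) = 0 := by
    intro i j hij
    by_cases hi : i ∈ S <;> by_cases hj : j ∈ S
    · simp only [v, hi, hj, dif_pos, sympC_basis_same]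
    · simp only [v, hi, hj, dif_pos, dif_neg, not_false_eq_true, sympC_basis_false_true]
      rw [if_neg]
      intro hh
      have := congrArg Subtype.val (a.injective hh)
      apply hij
      simp only at this
      rw [this, M.2.1]
    · simp only [v, hi, hj, dif_pos, dif_neg, not_false_eq_true]
      rw [sympC_swap, sympC_basis_false_true, if_neg, neg_zero]
      intro hh
      exact hij (congrArg Subtype.val (a.injective hh)).symm
    · simp only [v, hi, hj, dif_neg, not_false_eq_true, sympC_basis_same]
  refine ⟨v, fun M' => ?_⟩
  split_ifs with hM
  · subst hM
    refine Finset.prod_eq_one fun i hi => ?_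
    have hi' : M'.1 i ∉ S := by
      rw [hmem, M'.2.1]
      exact ((hmem i).1 hi).not_gt
    have hiS : i ∈ S := hi
    simp only [v, hiS, hi', dif_pos, dif_neg, not_false_eq_true, sympC_basis_false_true, M'.2.1,
      if_true]
  · obtain ⟨i, hi⟩ : ∃ i, M.1 i ≠ M'.1 i := by
      by_contra! hcon
      exact hM (Subtype.ext (Equiv.ext fun i => (hcon i).symm))
    rcases lt_or_gt_of_ne (M'.2.2 i) with hlt | hlt
    · refine Finset.prod_eq_zero (i := M'.1 i) (by simpa [M'.2.1] using hlt) ?_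
      rw [M'.2.1, sympC_swap, hne _ _ hi, neg_zero]
    · exact Finset.prod_eq_zero (i := i) (by simpa using hlt) (hne _ _ hi)

theorem linearIndependent_phiS {n r : ℕ} (h : r ≤ n) : LinearIndependent ℂ (phiS n r) := by
  classical
  rw [Fintype.linearIndependent_iff]
  intro g hg M
  obtain ⟨v, hv⟩ := exists_phiS_dual h M
  simpa [hv] using congrFun hg v

theorem prod_sympC_update (n r : ℕ) [DecidableEq (Fin r × Fin 2)]
    (w : Fin r × Fin 2 → Fin (2*n) → ℂ) (k : Fin r) (b : Fin 2) (z : Fin (2*n) → ℂ) :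
    ∏ j, sympC n (Function.update w (k, b) z (j, 0)) (Function.update w (k, b) z (j, 1)) =
      sympC n (Function.update w (k, b) z (k, 0)) (Function.update w (k, b) z (k, 1)) *
        ∏ j ∈ Finset.univ.erase k, sympC n (w (j, 0)) (w (j, 1)) := by
  rw [← Finset.mul_prod_erase _ _ (Finset.mem_univ k)]
  congr 1
  exact Finset.prod_congr rfl fun j hj => by simp [Finset.ne_of_mem_erase hj]

/-- The product `∏ₖ ω(w_{k,0}, w_{k,1})`, as a multilinear map in `w`. -/
noncomputable def sympProd (n r : ℕ) :
    MultilinearMap ℂ (fun _ : Fin r × Fin 2 => Fin (2*n) → ℂ) ℂ where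
  toFun w := ∏ k, sympC n (w (k, 0)) (w (k, 1))
  map_update_add' := by
    rintro _ w ⟨k, b⟩ x y
    simp only [prod_sympC_update]
    obtain rfl | rfl : b = 0 ∨ b = 1 := by omega
    all_goals simp [sympC_add_left, sympC_add_right, add_mul]
  map_update_smul' := by
    rintro _ w ⟨k, b⟩ c x
    simp only [prod_sympC_update]
    obtain rfl | rfl : b = 0 ∨ b = 1 := by omega
    all_goals simp [sympC_smul_left, sympC_smul_right, mul_assoc]

theorem sum_sign_sympProd_eq_zero {n r : ℕ} (h : n < r) (w : Fin r × Fin 2 → Fin (2*n) → ℂ) :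
    ∑ σ : Equiv.Perm (Fin r × Fin 2),
      ((Equiv.Perm.sign σ : ℤ) : ℂ) * ∏ k, sympC n (w (σ (k, 0))) (w (σ (k, 1))) = 0 := by
  have hdep : ¬ LinearIndependent ℂ w := fun hw => by
    have := hw.fintype_card_le_finrank
    simp at this
    omega
  have h0 := (MultilinearMap.alternatization (sympProd n r)).map_linearDependent w hdep
  rw [MultilinearMap.alternatization_apply] at h0
  rw [← h0]
  refine Finset.sum_congr rfl fun σ _ => ?_
  rw [Units.smul_def, zsmul_eq_mul]
  rfl

/-- The matching whose blocks are `{s (k, 0), s (k, 1)}`. -/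
def PM.ofEquiv {r : ℕ} (s : Fin r × Fin 2 ≃ Fin (2*r)) : PM (2*r) :=
  ⟨s.symm.trans ((Equiv.prodCongr (Equiv.refl _) (Equiv.swap 0 1)).trans s),
    fun i => by simp [Prod.map], fun i hi => by
      have h2 : ∀ b : Fin 2, Equiv.swap 0 1 b ≠ b := by decide
      have := congrArg Prod.snd ((Equiv.eq_symm_apply s).2 hi)
      exact h2 _ this⟩

theorem PM.ofEquiv_apply_zero {r : ℕ} (s : Fin r × Fin 2 ≃ Fin (2*r)) (k : Fin r) :
    (PM.ofEquiv s).1 (s (k, 0)) = s (k, 1) := by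
  simp [PM.ofEquiv]

theorem PM.ofEquiv_apply_one {r : ℕ} (s : Fin r × Fin 2 ≃ Fin (2*r)) (k : Fin r) :
    (PM.ofEquiv s).1 (s (k, 1)) = s (k, 0) := by
  simp [PM.ofEquiv]

theorem phiS_ofEquiv (n r : ℕ) (s : Fin r × Fin 2 ≃ Fin (2*r)) (v : Fin (2*r) → Fin (2*n) → ℂ) :
    phiS n r (PM.ofEquiv s) v = ∏ k, (if s (k, 0) < s (k, 1) then 1 else -1) *
      sympC n (v (s (k, 0))) (v (s (k, 1))) := by
  have hs : ∀ k, s (k, 0) ≠ s (k, 1) := fun k => by simp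
  refine Finset.prod_bij' (fun i _ => (s.symm i).1)
    (fun k _ => if s (k, 0) < s (k, 1) then s (k, 0) else s (k, 1)) ?_ ?_ ?_ ?_ ?_
  · simp
  · intro k _
    rw [Finset.mem_filter]
    refine ⟨Finset.mem_univ _, ?_⟩
    split_ifs with hk
    · rwa [PM.ofEquiv_apply_zero]
    · rw [PM.ofEquiv_apply_one]
      exact lt_of_le_of_ne (not_lt.1 hk) (hs k).symm
  · intro i hi
    obtain ⟨⟨k, b⟩, rfl⟩ := s.surjective i
    rw [Finset.mem_filter] at hi
    have hi := hi.2
    obtain rfl | rfl : b = 0 ∨ b = 1 := by omega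
    · rw [PM.ofEquiv_apply_zero] at hi
      simp [hi]
    · rw [PM.ofEquiv_apply_one] at hi
      simp [hi.not_gt]
  · intro k _
    split_ifs <;> simp
  · intro i hi
    obtain ⟨⟨k, b⟩, rfl⟩ := s.surjective i
    rw [Finset.mem_filter] at hi
    have hi := hi.2
    obtain rfl | rfl : b = 0 ∨ b = 1 := by omega
    · rw [PM.ofEquiv_apply_zero] at hi ⊢
      simp [hi]
    · rw [PM.ofEquiv_apply_one] at hi ⊢
      simp only [Equiv.symm_apply_apply, hi.not_gt, if_false]
      rw [sympC_swap]
      ring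

theorem prod_orient_mul_phiS_ofEquiv (n r : ℕ) (s : Fin r × Fin 2 ≃ Fin (2*r))
    (v : Fin (2*r) → Fin (2*n) → ℂ) :
    (∏ k, (if s (k, 0) < s (k, 1) then (1 : ℂ) else -1)) * phiS n r (PM.ofEquiv s) v =
      ∏ k, sympC n (v (s (k, 0))) (v (s (k, 1))) := by
  rw [phiS_ofEquiv, ← Finset.prod_mul_distrib]
  refine Finset.prod_congr rfl fun k _ => ?_
  split_ifs <;> ring

/-- A permutation of `Fin r × Fin 2` preserving the blocks `{k} × Fin 2` has sign `(-1)^f`,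
where `f` counts the blocks on which it exchanges the two levels. -/
theorem sign_of_preserves_blocks {r : ℕ} (σ : Equiv.Perm (Fin r × Fin 2))
    (hσ : ∀ k, σ (k, 1) = ((σ (k, 0)).1, Equiv.swap 0 1 (σ (k, 0)).2)) :
    Equiv.Perm.sign σ = ∏ k, if (σ (k, 0)).2 = 0 then 1 else -1 := by
  let f : Fin r → Equiv.Perm (Fin 2) := fun k => if (σ (k, 0)).2 = 0 then 1 else Equiv.swap 0 1
  have hinj : Function.Injective fun k => (σ (k, 0)).1 := by
    intro k l hkl
    simp only at hkl
    by_cases h : (σ (k, 0)).2 = (σ (l, 0)).2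
    · simpa using σ.injective (Prod.ext hkl h)
    · have h2 : ∀ b c : Fin 2, b ≠ c → b = Equiv.swap 0 1 c := by decide
      have : σ (k, 0) = σ (l, 1) := by
        rw [hσ l]
        exact Prod.ext hkl (h2 _ _ h)
      simpa using σ.injective this
  let π : Equiv.Perm (Fin r) := Equiv.ofBijective _ (Finite.injective_iff_bijective.1 hinj)
  have h : σ = (Equiv.prodCongrRight f).trans (Equiv.prodCongrLeft fun _ => π) := by
    ext1 ⟨k, b⟩
    have h2 : ∀ c : Fin 2, (if c = 0 then (1 : Equiv.Perm (Fin 2)) else Equiv.swap 0 1) 0 = c ∧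
      (if c = 0 then (1 : Equiv.Perm (Fin 2)) else Equiv.swap 0 1) 1 = Equiv.swap 0 1 c := by
      decide
    obtain rfl | rfl : b = 0 ∨ b = 1 := by omega
    · exact Prod.ext rfl (h2 _).1.symm
    · rw [hσ]
      exact Prod.ext rfl (h2 _).2.symm
  conv_lhs => rw [h]
  rw [Equiv.Perm.sign_trans, Equiv.Perm.sign_prodCongrRight, Equiv.Perm.sign_prodCongrLeft]
  simp only [Fin.prod_univ_two, Int.units_mul_self, one_mul, f]
  refine Finset.prod_congr rfl fun k _ => ?_
  split_ifs
  · simp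
  · exact Equiv.Perm.sign_swap (by decide)

/-- The enumeration `(k, b) ↦ 2k + b` of the points of the standard matching. -/
def stdEquiv (r : ℕ) : Fin r × Fin 2 ≃ Fin (2*r) :=
  finProdFinEquiv.trans (finCongr (mul_comm r 2))

theorem sign_mul_orient_of_ofEquiv_eq {r : ℕ} (σ : Equiv.Perm (Fin r × Fin 2))
    (hσ : PM.ofEquiv (σ.trans (stdEquiv r)) = PM.ofEquiv (stdEquiv r)) :
    ((Equiv.Perm.sign σ : ℤ) : ℂ) * ∏ k, (if (σ.trans (stdEquiv r)) (k, 0) <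
      (σ.trans (stdEquiv r)) (k, 1) then (1 : ℂ) else -1) = 1 := by
  have hb : ∀ k, σ (k, 1) = ((σ (k, 0)).1, Equiv.swap 0 1 (σ (k, 0)).2) := by
    intro k
    have h := PM.ofEquiv_apply_zero (σ.trans (stdEquiv r)) k
    rw [hσ] at h
    simpa [PM.ofEquiv, Prod.map] using h.symm
  have ho : ∀ k, ((σ.trans (stdEquiv r)) (k, 0) < (σ.trans (stdEquiv r)) (k, 1)) ↔
      (σ (k, 0)).2 = 0 := by
    intro k
    simp only [Equiv.trans_apply, hb]
    generalize σ (k, 0) = p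
    obtain ⟨l, b⟩ := p
    obtain rfl | rfl : b = 0 ∨ b = 1 := by omega
    · simp [stdEquiv, Fin.lt_def]
    · simp [stdEquiv, Fin.lt_def]
  simp only [ho, sign_of_preserves_blocks σ hb, Units.coe_prod, Int.cast_prod]
  rw [← Finset.prod_mul_distrib]
  refine Finset.prod_eq_one fun k _ => ?_
  split_ifs <;> simp

theorem not_linearIndependent_phiS {n r : ℕ} (h : n < r) : ¬ LinearIndependent ℂ (phiS n r) := by
  classical
  intro hli
  let c : Equiv.Perm (Fin r × Fin 2) → ℂ := fun σ => ((Equiv.Perm.sign σ : ℤ) : ℂ) *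
    ∏ k, (if (σ.trans (stdEquiv r)) (k, 0) < (σ.trans (stdEquiv r)) (k, 1) then (1 : ℂ) else -1)
  let m : Equiv.Perm (Fin r × Fin 2) → PM (2*r) := fun σ => PM.ofEquiv (σ.trans (stdEquiv r))
  have hrel : ∑ M, (∑ σ with m σ = M, c σ) • phiS n r M = 0 := by
    funext v
    rw [Finset.sum_apply, Pi.zero_apply, ← sum_sign_sympProd_eq_zero h fun p => v (stdEquiv r p),
      ← Finset.sum_fiberwise Finset.univ m]
    refine Finset.sum_congr rfl fun M _ => ?_
    rw [Pi.smul_apply, smul_eq_mul, Finset.sum_mul]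
    refine Finset.sum_congr rfl fun σ hσ => ?_
    rw [← (Finset.mem_filter.1 hσ).2, mul_assoc, prod_orient_mul_phiS_ofEquiv]
    rfl
  have h0 := Fintype.linearIndependent_iff.1 hli _ hrel (PM.ofEquiv (stdEquiv r))
  rw [Finset.sum_congr rfl fun σ hσ =>
    sign_mul_orient_of_ofEquiv_eq σ (Finset.mem_filter.1 hσ).2, Finset.sum_const, nsmul_one,
    Nat.cast_eq_zero, Finset.card_eq_zero] at h0
  exact Finset.notMem_empty (1 : Equiv.Perm (Fin r × Fin 2))
    (h0.subset (Finset.mem_filter.2 ⟨Finset.mem_univ _, rfl⟩))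

/-- For `n ≥ 1`, `r ≥ 1`, the family of `2r`-multilinear forms `φ_M`,
indexed by the perfect matchings of `{1,…,2r}`, built from the standard symplectic form on
`ℂ^{2n}`, is linearly independent iff `r ≤ n`. -/
theorem stmt1 (n r : ℕ) (hn : 1 ≤ n) (hr : 1 ≤ r) :
    LinearIndependent ℂ (phiS n r) ↔ r ≤ n := by
  exact ⟨fun hli => not_lt.1 fun h => not_linearIndependent_phiS h hli, linearIndependent_phiS⟩
end

section
/- Let m ≥ 1 and let λ = (2^m), a partition of 2m, so that the rows of t^λ are {2i−1, 2i} for 1 ≤ i ≤ m and its first column is C₁ = {1,3,…,2m−1}. Let α⁻(C₁) = Σ_σ sgn(σ)·σ ∈ ℂ[S_{2m}], the signed sum over all permutations σ of {1,…,2m} that fix every even number and permute C₁. Then c_λ · (1 2) · α⁻(C₁) = (m−1)! · c_λ in ℂ[S_{2m}], where (1 2) is the transposition exchanging 1 and 2. -/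
open scoped BigOperators

/-- Row index (0-based) of the number `k` (0-based) in the tableau `t^λ` obtained by filling
`0,…,(sum l)-1` left-to-right along successive rows of the partition `l`. -/
def rowIdx : List ℕ → ℕ → ℕ
  | [], _ => 0
  | a :: t, k => if k < a then 0 else rowIdx t (k - a) + 1

/-- Column index (0-based) of the number `k` (0-based) in the tableau `t^λ`. -/
def colIdx : List ℕ → ℕ → ℕ
  | [], k => k
  | a :: t, k => if k < a then k else colIdx t (k - a)

/-- Extended row index: numbers outside the tableau each get their own singleton "row",
so that row-preserving permutations fix them pointwise. -/
def rowIdxE (l : List ℕ) (k : ℕ) : ℕ := if k < l.sum then rowIdx l k else l.length + k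

/-- Extended column index: numbers outside the tableau each get their own singleton "column". -/
def colIdxE (l : List ℕ) (k : ℕ) : ℕ := if k < l.sum then colIdx l k else l.headD 0 + k

/-- `x_λ`: the sum (in `ℂ[S_N]`) over the row stabiliser of `t^λ`
(permutations preserving each row of `t^λ` setwise and fixing all other numbers). -/
noncomputable def rowSym (N : ℕ) (l : List ℕ) : MonoidAlgebra ℂ (Equiv.Perm (Fin N)) :=
  ∑ σ ∈ Finset.univ.filter
      (fun σ : Equiv.Perm (Fin N) => ∀ k : Fin N, rowIdxE l (σ k).val = rowIdxE l k.val),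
    MonoidAlgebra.single σ (1:ℂ)

/-- `y_λ`: the signed sum (in `ℂ[S_N]`) over the column stabiliser of `t^λ`. -/
noncomputable def colSym (N : ℕ) (l : List ℕ) : MonoidAlgebra ℂ (Equiv.Perm (Fin N)) :=
  ∑ σ ∈ Finset.univ.filter
      (fun σ : Equiv.Perm (Fin N) => ∀ k : Fin N, colIdxE l (σ k).val = colIdxE l k.val),
    MonoidAlgebra.single σ ((Equiv.Perm.sign σ : ℤ) : ℂ)

/-- The Young symmetriser `c_λ = x_λ · y_λ` of the tableau `t^λ`, inside `ℂ[S_N]`. -/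
noncomputable def youngSym (N : ℕ) (l : List ℕ) : MonoidAlgebra ℂ (Equiv.Perm (Fin N)) :=
  rowSym N l * colSym N l

/-- `α⁻(C₁)`: the signed sum over all permutations of `{1,…,2m}` that fix every even number
(1-based) and permute the first column `C₁ = {1,3,…,2m-1}` of `t^{(2^m)}`.
(0-indexed: permutations fixing every `k` with `k % 2 = 1`.) -/
noncomputable def alphaC1 (m : ℕ) : MonoidAlgebra ℂ (Equiv.Perm (Fin (2*m))) :=
  ∑ σ ∈ Finset.univ.filter
      (fun σ : Equiv.Perm (Fin (2*m)) => ∀ k : Fin (2*m), k.val % 2 = 1 → σ k = k),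
    MonoidAlgebra.single σ ((Equiv.Perm.sign σ : ℤ) : ℂ)

open Equiv Finset MonoidAlgebra

/-- The sum over a subgroup `H`, weighted by a character `χ`, in the complex group algebra. -/
noncomputable def characterSum {G : Type*} [Group G] [Fintype G] (χ : G →* ℂ) (H : Subgroup G) :
    MonoidAlgebra ℂ G :=
  open Classical in ∑ g with g ∈ H, single g (χ g)

section characterSum

variable {G : Type*} [Group G] [Fintype G] (χ : G →* ℂ) {H : Subgroup G}

theorem characterSum_mul_single {h : G} (hh : h ∈ H) :
    characterSum χ H * single h (χ h) = characterSum χ H := by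
  classical
  rw [characterSum, sum_mul]
  refine sum_equiv (Equiv.mulRight h) (fun g => ?_) (fun g _ => ?_)
  · simp [H.mul_mem_cancel_right hh]
  · simp [single_mul_single]

theorem single_mul_characterSum {h : G} (hh : h ∈ H) :
    single h (χ h) * characterSum χ H = characterSum χ H := by
  classical
  rw [characterSum, mul_sum]
  refine sum_equiv (Equiv.mulLeft h) (fun g => ?_) (fun g _ => ?_)
  · simp [H.mul_mem_cancel_left hh]
  · simp [single_mul_single]

theorem characterSum_mul_characterSum {K : Subgroup G} (hHK : H ≤ K) :
    characterSum χ K * characterSum χ H = (Nat.card H : ℂ) • characterSum χ K := by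
  classical
  conv_lhs => rw [characterSum.eq_1 χ H, mul_sum]
  rw [sum_congr rfl fun h hh => characterSum_mul_single χ (hHK (mem_filter.1 hh).2), sum_const,
    ← Nat.cast_smul_eq_nsmul ℂ, Nat.card_eq_fintype_card, Fintype.card_subtype]

end characterSum

/-- The sign character of a symmetric group, with complex values. -/
noncomputable def signCharacter (α : Type*) [Fintype α] [DecidableEq α] : Perm α →* ℂ :=
  (Int.castRingHom ℂ).toMonoidHom.comp ((Units.coeHom ℤ).comp Perm.sign)

/-- The permutations preserving every fiber of `f`. -/
def fiberStabilizer {α β : Type*} (f : α → β) : Subgroup (Perm α) where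
  carrier := {σ | ∀ a, f (σ a) = f a}
  mul_mem' hσ hτ a := by rw [Perm.mul_apply, hσ, hτ]
  one_mem' _ := rfl
  inv_mem' {σ} hσ a := by rw [← hσ (σ⁻¹ a), ← Perm.mul_apply, mul_inv_cancel, Perm.one_apply]

theorem mem_fiberStabilizer {α β : Type*} {f : α → β} {σ : Perm α} :
    σ ∈ fiberStabilizer f ↔ ∀ a, f (σ a) = f a := Iff.rfl

theorem card_fixingSubgroup_perm {α : Type*} [Fintype α] (S : Set α) :
    Nat.card (fixingSubgroup (Perm α) S) = (Nat.card (Sᶜ : Set α)).factorial := by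
  classical
  rw [← Nat.card_perm]
  refine Nat.card_congr (Equiv.trans (Equiv.subtypeEquivRight fun σ => ?_)
    (Perm.subtypeEquivSubtypePerm (· ∈ Sᶜ)).symm)
  simp [mem_fixingSubgroup_iff]

section

variable {α : Type*} [Fintype α] [DecidableEq α]

theorem signCharacter_apply (σ : Perm α) : signCharacter α σ = ((Perm.sign σ : ℤ) : ℂ) := rfl

theorem signCharacter_swap {a b : α} (hab : a ≠ b) : signCharacter α (swap a b) = -1 := by
  simp [signCharacter_apply, Perm.sign_swap hab]

theorem card_fixingSubgroup_perm_apply_eq {S : Set α} {a b : α} (ha : a ∉ S) (hb : b ∉ S) :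
    Nat.card {h : Perm α // h ∈ fixingSubgroup (Perm α) S ∧ h a = b} =
      (Nat.card (Sᶜ : Set α) - 1).factorial := by
  have hcard : Nat.card ((insert a S)ᶜ : Set α) = Nat.card (Sᶜ : Set α) - 1 := by
    have : (insert a S)ᶜ = Sᶜ \ {a} := by ext; simp [and_comm]
    rw [this, Nat.card_coe_set_eq, Nat.card_coe_set_eq, Set.ncard_sdiff_singleton_of_mem ha]
  rw [← hcard, ← card_fixingSubgroup_perm]
  refine Nat.card_congr ((Equiv.mulLeft (swap a b)).subtypeEquiv fun σ => ?_)
  have hswap : ∀ y ∈ S, swap a b y = y := fun y hy =>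
    swap_apply_of_ne_of_ne (fun h => ha (h ▸ hy)) (fun h => hb (h ▸ hy))
  simp only [mem_fixingSubgroup_iff, Set.forall_mem_insert, Perm.smul_def, coe_mulLeft,
    Perm.mul_apply]
  constructor
  · rintro ⟨h1, h2⟩
    exact ⟨by simp [h2], fun y hy => by rw [h1 y hy, hswap y hy]⟩
  · rintro ⟨h1, h2⟩
    refine ⟨fun y hy => (swap a b).injective ?_, (swap a b).injective ?_⟩
    · rw [h2 y hy, hswap y hy]
    · rw [h1, swap_apply_right]

theorem card_doubleCoset_fiber {S : Set α} {i j : α} (hi : i ∈ S) (hj : j ∉ S) (k : Perm α) :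
    Nat.card {h : Perm α // h ∈ fixingSubgroup (Perm α) S ∧
        k * h⁻¹ * swap i j ∈ fixingSubgroup (Perm α) S} =
      open Classical in
      if k ∈ fixingSubgroup (Perm α) (S \ {i}) ∧ k ∉ fixingSubgroup (Perm α) S then
        (Nat.card (Sᶜ : Set α) - 1).factorial else 0 := by
  have hij : j ≠ i := fun h => hj (h ▸ hi)
  have hswap : ∀ y ∈ S, y ≠ i → swap i j y = y := fun y hy hyi =>
    swap_apply_of_ne_of_ne hyi (fun h => hj (h ▸ hy))
  split_ifs with hk <;>
    simp only [mem_fixingSubgroup_iff, Perm.smul_def, Perm.mul_apply, Set.mem_sdiff,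
      Set.mem_singleton_iff] at hk ⊢
  · obtain ⟨hK, hH⟩ := hk
    have hki : k i ≠ i := fun h => hH fun y hy => by
      by_cases hyi : y = i
      · rw [hyi, h]
      · exact hK y ⟨hy, hyi⟩
    have ha : k⁻¹ i ∉ S := fun h => by
      by_cases hyi : k⁻¹ i = i
      · exact hki (by rw [Perm.inv_eq_iff_eq] at hyi; exact hyi.symm)
      · have := hK _ ⟨h, hyi⟩
        rw [← Perm.mul_apply, mul_inv_cancel, Perm.one_apply] at this
        exact hyi this.symm
    rw [← card_fixingSubgroup_perm_apply_eq ha hj]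
    refine Nat.card_congr (Equiv.subtypeEquivRight fun h => ?_)
    simp only [mem_fixingSubgroup_iff, Perm.smul_def]
    refine and_congr_right fun hh => ?_
    have hinv : ∀ y ∈ S, h⁻¹ y = y := fun y hy => by rw [Perm.inv_eq_iff_eq, hh y hy]
    constructor
    · intro H
      have := H i hi
      rw [swap_apply_left, ← Perm.eq_inv_iff_eq, Perm.inv_eq_iff_eq] at this
      exact this.symm
    · intro H y hy
      by_cases hyi : y = i
      · rw [hyi, swap_apply_left, ← Perm.eq_inv_iff_eq, Perm.inv_eq_iff_eq, H]
      · rw [hswap y hy hyi, hinv y hy, hK y ⟨hy, hyi⟩]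
  · rw [Nat.card_eq_zero]
    refine Or.inl ⟨fun ⟨h, hh, H⟩ => hk ⟨fun y hy => ?_, fun hH => ?_⟩⟩
    · have := H y hy.1
      rwa [hswap y hy.1 hy.2, Perm.inv_eq_iff_eq.2 (hh y hy.1).symm] at this
    · have := H i hi
      rw [swap_apply_left, ← Perm.eq_inv_iff_eq, Perm.inv_eq_iff_eq,
        Perm.inv_eq_iff_eq.2 (hH i hi).symm, hh i hi] at this
      exact hij this

theorem characterSum_mul_swap_mul_characterSum {S : Set α} {i j : α} (hi : i ∈ S) (hj : j ∉ S) :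
    characterSum (signCharacter α) (fixingSubgroup (Perm α) S) * single (swap i j) 1 *
        characterSum (signCharacter α) (fixingSubgroup (Perm α) S) =
      ((Nat.card (Sᶜ : Set α) - 1).factorial : ℂ) •
        (characterSum (signCharacter α) (fixingSubgroup (Perm α) S) -
          characterSum (signCharacter α) (fixingSubgroup (Perm α) (S \ {i}))) := by
  classical
  set χ := signCharacter α
  set H := fixingSubgroup (Perm α) S
  set K := fixingSubgroup (Perm α) (S \ {i})
  have hHK : H ≤ K := fixingSubgroup_antitone (Perm α) α Set.sdiff_subset
  have hij : i ≠ j := fun h => hj (h ▸ hi)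
  have reindex (h : Perm α) :
      characterSum χ H * single (swap i j) 1 * single h (χ h) =
        ∑ k, if k * h⁻¹ * swap i j ∈ H then single k (-χ k) else 0 := by
    rw [characterSum, sum_mul, sum_mul, sum_filter]
    refine Fintype.sum_equiv (Equiv.mulRight (swap i j * h)) _ _ fun g => ?_
    have : χ (swap i j) = -1 := signCharacter_swap hij
    simp [single_mul_single, mul_assoc, this]
  have hdiff : characterSum χ H - characterSum χ K =
      ∑ k, if k ∈ K ∧ k ∉ H then single k (-χ k) else 0 := by
    rw [characterSum, characterSum, sum_filter, sum_filter, ← sum_sub_distrib]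
    refine sum_congr rfl fun k _ => ?_
    by_cases h1 : k ∈ H
    · simp [h1, hHK h1]
    · by_cases h2 : k ∈ K <;> simp [h1, h2]
  rw [hdiff]
  conv_lhs => rw [characterSum.eq_1 χ H, mul_sum]
  rw [← characterSum.eq_1 χ H, sum_congr rfl fun h _ => reindex h, sum_comm, smul_sum]
  refine sum_congr rfl fun k _ => ?_
  rw [← sum_filter, filter_filter, sum_const, ← Fintype.card_subtype, ← Nat.card_eq_fintype_card,
    card_doubleCoset_fiber hi hj, ← Nat.cast_smul_eq_nsmul ℂ]
  split_ifs <;> simp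

/-- The Garnir relation. -/
theorem characterSum_fiberStabilizer_mul_characterSum_fixingSubgroup {β : Type*} (f : α → β)
    (S : Set α) (hf : ∀ g : Perm α, ¬ Set.InjOn (f ∘ g) Sᶜ) (y : MonoidAlgebra ℂ (Perm α)) :
    characterSum 1 (fiberStabilizer f) * y *
      characterSum (signCharacter α) (fixingSubgroup (Perm α) S) = 0 := by
  induction y using MonoidAlgebra.induction_linear with
  | zero => simp
  | add y z hy hz => rw [mul_add, add_mul, hy, hz, add_zero]
  | single g r =>
    obtain ⟨a, ha, b, hb, hfab, hab⟩ : ∃ a ∈ Sᶜ, ∃ b ∈ Sᶜ, f (g a) = f (g b) ∧ a ≠ b := by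
      have := hf g
      simp only [Set.InjOn] at this
      push Not at this
      exact this
    have hrow : swap (g a) (g b) ∈ fiberStabilizer f := fun c => by
      rcases eq_or_ne c (g a) with rfl | h1
      · rw [swap_apply_left, hfab]
      rcases eq_or_ne c (g b) with rfl | h2
      · rw [swap_apply_right, hfab]
      rw [swap_apply_of_ne_of_ne h1 h2]
    have hcol : swap a b ∈ fixingSubgroup (Perm α) S := by
      rw [mem_fixingSubgroup_iff]
      exact fun y hy => swap_apply_of_ne_of_ne (fun h => ha (h ▸ hy)) (fun h => hb (h ▸ hy))
    set A := characterSum (signCharacter α) (fixingSubgroup (Perm α) S)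
    set X := characterSum (1 : Perm α →* ℂ) (fiberStabilizer f)
    have hX : X * single (swap (g a) (g b)) 1 = X := characterSum_mul_single 1 hrow
    have hA : single (swap a b) (-1) * A = A := by
      rw [← signCharacter_swap hab]
      exact single_mul_characterSum _ hcol
    have hcomm : single (swap (g a) (g b)) 1 * single g r =
        -(single g r * single (swap a b) (-1)) := by
      rw [single_mul_single, single_mul_single, mul_swap_eq_swap_mul]
      simp
    have h : X * single g r * A = -(X * single g r * A) := by
      conv_lhs => rw [← hX, mul_assoc X, hcomm, mul_neg, neg_mul, mul_assoc, mul_assoc, hA,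
        ← mul_assoc]
    have h2 : (2 : ℂ) • (X * single g r * A) = 0 := by
      rw [two_smul]
      exact eq_neg_iff_add_eq_zero.1 h
    exact (smul_eq_zero.1 h2).resolve_left two_ne_zero

end

theorem rowIdx_replicate_two {m k : ℕ} (hk : k < 2 * m) :
    rowIdx (List.replicate m 2) k = k / 2 := by
  induction m generalizing k with
  | zero => omega
  | succ m ih =>
    rw [List.replicate_succ, rowIdx]
    split_ifs with h
    · omega
    · rw [ih (by omega)]; omega

theorem colIdx_replicate_two {m k : ℕ} (hk : k < 2 * m) :
    colIdx (List.replicate m 2) k = k % 2 := by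
  induction m generalizing k with
  | zero => omega
  | succ m ih =>
    rw [List.replicate_succ, colIdx]
    split_ifs with h
    · omega
    · rw [ih (by omega)]; omega

theorem rowSym_replicate_two (m : ℕ) :
    rowSym (2 * m) (List.replicate m 2) =
      characterSum 1 (fiberStabilizer fun k : Fin (2 * m) => k.val / 2) := by
  classical
  have hrow (k : Fin (2 * m)) : rowIdxE (List.replicate m 2) k = k.val / 2 := by
    rw [rowIdxE, if_pos (by simp [mul_comm m]), rowIdx_replicate_two k.isLt]
  simp only [rowSym, characterSum, hrow, mem_fiberStabilizer, MonoidHom.one_apply]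

theorem colSym_replicate_two (m : ℕ) :
    colSym (2 * m) (List.replicate m 2) =
      characterSum (signCharacter _) (fiberStabilizer fun k : Fin (2 * m) => k.val % 2) := by
  classical
  have hcol (k : Fin (2 * m)) : colIdxE (List.replicate m 2) k = k.val % 2 := by
    rw [colIdxE, if_pos (by simp [mul_comm m]), colIdx_replicate_two k.isLt]
  simp only [colSym, characterSum, hcol]
  refine sum_congr ?_ fun _ _ => rfl
  ext; simp [mem_fiberStabilizer]

theorem alphaC1_eq_characterSum (m : ℕ) :
    alphaC1 m = characterSum (signCharacter _)
      (fixingSubgroup (Perm (Fin (2 * m))) {k : Fin (2 * m) | k.val % 2 = 1}) := by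
  classical
  refine sum_congr ?_ fun _ _ => rfl
  ext; simp [mem_fixingSubgroup_iff]

theorem card_compl_odd (m : ℕ) :
    Nat.card ({k : Fin (2 * m) | k.val % 2 = 1}ᶜ : Set (Fin (2 * m))) = m := by
  refine (Nat.card_congr (β := Fin m) ?_).trans (Nat.card_fin m)
  refine
    { toFun k := ⟨k.1.val / 2, by omega⟩
      invFun k := ⟨⟨2 * k.val, by omega⟩, by simp⟩
      left_inv k := ?_
      right_inv k := by ext; simp }
  obtain ⟨k, hk⟩ := k
  simp only [Set.mem_compl_iff, Set.mem_ofPred_eq] at hk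
  ext
  simp only
  omega

/-- For `λ = (2^m)`: `c_λ · (1 2) · α⁻(C₁) = (m-1)! · c_λ` in `ℂ[S_{2m}]`
(0-indexed, `(1 2)` is the transposition swapping `0` and `1`). -/
theorem stmt10 (m : ℕ) (hm : 1 ≤ m) :
    youngSym (2*m) (List.replicate m 2) *
        MonoidAlgebra.single (Equiv.swap (⟨0, by omega⟩ : Fin (2*m)) ⟨1, by omega⟩) (1:ℂ) *
        alphaC1 m =
      ((Nat.factorial (m-1) : ℂ)) • youngSym (2*m) (List.replicate m 2) := by
  set S : Set (Fin (2 * m)) := {k | k.val % 2 = 1}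
  set i : Fin (2 * m) := ⟨1, by omega⟩
  set j : Fin (2 * m) := ⟨0, by omega⟩
  have hi : i ∈ S := by simp [S, i]
  have hj : j ∉ S := by simp [S, j]
  rw [youngSym, rowSym_replicate_two, colSym_replicate_two, alphaC1_eq_characterSum, swap_comm]
  set X := characterSum 1 (fiberStabilizer fun k : Fin (2 * m) => k.val / 2)
  set Y := characterSum (signCharacter _) (fiberStabilizer fun k : Fin (2 * m) => k.val % 2)
  set A := characterSum (signCharacter _) (fixingSubgroup (Perm (Fin (2 * m))) S)
  set B := characterSum (signCharacter _) (fixingSubgroup (Perm (Fin (2 * m))) (S \ {i}))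
  have hYA : Y * A = (m.factorial : ℂ) • Y := by
    have hle : fixingSubgroup (Perm (Fin (2 * m))) S ≤
        fiberStabilizer fun k : Fin (2 * m) => k.val % 2 := fun σ hσ k => by
      rw [mem_fixingSubgroup_iff] at hσ
      by_cases hk : k ∈ S
      · rw [show σ k = k from hσ k hk]
      · have hσk : σ k ∉ S := fun h => hk (σ.injective (hσ _ h) ▸ h)
        simp only [S, Set.mem_ofPred_eq] at hk hσk
        show (σ k).val % 2 = k.val % 2
        omega
    rw [characterSum_mul_characterSum _ hle, card_fixingSubgroup_perm, card_compl_odd]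
  have hAsA : A * single (swap i j) 1 * A = ((m - 1).factorial : ℂ) • (A - B) := by
    rw [characterSum_mul_swap_mul_characterSum hi hj, card_compl_odd]
  have hXB : X * Y * B = 0 := by
    refine characterSum_fiberStabilizer_mul_characterSum_fixingSubgroup _ _ (fun g hg => ?_) Y
    have hle : ((S \ {i})ᶜ : Set (Fin (2 * m))).ncard ≤ (Set.Iio m).ncard :=
      Set.ncard_le_ncard_of_injOn _ (fun k _ => by simp; omega) hg (Set.finite_Iio m)
    have hS : (S \ {i})ᶜ = insert i Sᶜ := by
      ext k
      by_cases h : k = i <;> simp [h, hi]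
    rw [hS, Set.ncard_insert_of_notMem (by simpa using hi), ← Nat.card_coe_set_eq,
      card_compl_odd, ← Nat.card_coe_set_eq] at hle
    simp at hle
  have hm0 : (m.factorial : ℂ) ≠ 0 := Nat.cast_ne_zero.2 m.factorial_ne_zero
  refine smul_right_injective _ hm0 ?_
  calc (m.factorial : ℂ) • (X * Y * single (swap i j) 1 * A)
      = X * (Y * A) * single (swap i j) 1 * A := by simp [hYA]
    _ = X * Y * (A * single (swap i j) 1 * A) := by simp only [mul_assoc]
    _ = ((m - 1).factorial : ℂ) • (X * (Y * A) - X * Y * B) := by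
      rw [hAsA, mul_smul_comm, mul_sub, mul_assoc X Y A]
    _ = (m.factorial : ℂ) • ((m - 1).factorial : ℂ) • (X * Y) := by
      rw [hXB, sub_zero, hYA, mul_smul_comm, smul_comm]
end

section
/- Let m ≥ 1 and let k be an integer with 0 ≤ k and k+1 ≤ ⌊(m+1)/2⌋. In ℂ[S_{m+1}], define F_k = (Σ_σ sgn(σ)·σ)·(Σ_τ sgn(τ)·τ), where σ ranges over the permutations of {1,…,m+1} that fix m+2−k,…,m+1 pointwise (so σ permutes {1,…,m+1−k}) and τ ranges over the permutations that fix 1,…,m+1−k pointwise (so τ permutes {m+2−k,…,m+1}). Then the two-sided ideal of ℂ[S_{m+1}] generated by F_k is contained in the two-sided ideal generated by F_{k+1}. -/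
open scoped BigOperators

/-- The element `F_k ∈ ℂ[S_{m+1}]`: the product of the signed sum over the permutations of
`{1,…,m+1-k}` (fixing the last `k` points) with the signed sum over the permutations of
`{m+2-k,…,m+1}` (fixing the first `m+1-k` points); 0-indexed on `Fin (m+1)`. -/
noncomputable def Fkelt (m k : ℕ) : MonoidAlgebra ℂ (Equiv.Perm (Fin (m+1))) :=
  (∑ σ ∈ Finset.univ.filter
      (fun σ : Equiv.Perm (Fin (m+1)) => ∀ i : Fin (m+1), m + 1 - k ≤ i.val → σ i = i),
    MonoidAlgebra.single σ ((Equiv.Perm.sign σ : ℤ) : ℂ)) *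
  (∑ τ ∈ Finset.univ.filter
      (fun τ : Equiv.Perm (Fin (m+1)) => ∀ i : Fin (m+1), i.val < m + 1 - k → τ i = i),
    MonoidAlgebra.single τ ((Equiv.Perm.sign τ : ℤ) : ℂ))

open scoped Pointwise

open Finset Equiv

section SignedSums

variable {α : Type*} [DecidableEq α]

theorem smul_eq_of_fixes {S : Finset α} {g : Perm α} (h : ∀ i ∈ S, g i = i) : g • S = S := by
  rw [← Finset.coe_inj, coe_smul_finset, ← Set.image_smul]
  exact (Set.image_congr h).trans (Set.image_id' _)

theorem smul_eq_of_fixes_compl {S : Finset α} {g : Perm α} (h : ∀ i ∉ S, g i = i) :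
    g • S = S := by
  refine eq_of_subset_of_card_le (fun x hx => ?_) (card_smul_finset g S).ge
  obtain ⟨y, hy, rfl⟩ := mem_smul_finset.1 hx
  by_contra hn
  have hgy : g y = y := g.injective (h _ hn)
  exact hn (by simpa [hgy] using hy)

theorem exists_perm_smul_eq {S S' : Finset α} (h : #S = #S') : ∃ g : Perm α, g • S = S' := by
  obtain ⟨g, hg⟩ := (Set.powersetCard.isPretransitive (α := α) (n := #S')).exists_smul_eq
    ⟨S, h⟩ ⟨S', rfl⟩
  exact ⟨g, congrArg Subtype.val hg⟩

variable [Fintype α]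

/-- The element `sgn(σ)·σ` of the group algebra. -/
noncomputable def signedPerm (σ : Perm α) : MonoidAlgebra ℂ (Perm α) :=
  MonoidAlgebra.single σ ((Perm.sign σ : ℤ) : ℂ)

theorem signedPerm_mul (σ τ : Perm α) :
    signedPerm (σ * τ) = signedPerm σ * signedPerm τ := by
  simp [signedPerm, MonoidAlgebra.single_mul_single]

/-- The signed sum of the permutations which carry `T` into `S`. -/
noncomputable def signedSumInto (T S : Finset α) : MonoidAlgebra ℂ (Perm α) :=
  ∑ w : Perm α with w • T ⊆ S, signedPerm w

theorem signedPerm_mul_signedSumInto (T S : Finset α) (g : Perm α) :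
    signedPerm g * signedSumInto T S = signedSumInto T (g • S) := by
  rw [signedSumInto, signedSumInto, mul_sum]
  refine sum_nbij' (fun w => g * w) (fun w => g⁻¹ * w) ?_ ?_ ?_ ?_ ?_
  · intro w hw
    simpa [mul_smul] using hw
  · intro w hw
    simpa [mul_smul, Finset.subset_smul_finset_iff] using hw
  · simp
  · simp
  · intro w _
    rw [signedPerm_mul]

theorem sum_signedPerm_mul_signedSumInto (T S : Finset α) (H : Finset (Perm α))
    (hH : ∀ h ∈ H, h • S = S) :
    (∑ h ∈ H, signedPerm h) * signedSumInto T S = (#H : ℂ) • signedSumInto T S := by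
  rw [sum_mul, sum_congr rfl (g := fun _ => signedSumInto T S)]
  · simp [Nat.cast_smul_eq_nsmul]
  · intro h hh
    rw [signedPerm_mul_signedSumInto, hH h hh]

/-- The coefficients of a left inverse of the inclusion matrix between `k`-subsets and
`(k+1)`-subsets, where `N` is the size of the complement of a `k`-subset. -/
noncomputable def inclusionInvCoeff (N : ℕ) : ℕ → ℂ
  | 0 => 1 / N
  | t + 1 => -((t + 1 : ℕ) * inclusionInvCoeff N t) / (N - (t + 1 : ℕ))

theorem sum_inclusionInvCoeff (T R : Finset α) (hcard : #R = #T) (hT : #T < #Tᶜ) :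
    ∑ S : Finset α with #S = #T + 1 ∧ R ⊆ S, inclusionInvCoeff #Tᶜ #(T \ S) =
      if R = T then 1 else 0 := by
  have himage : (univ.filter fun S : Finset α => #S = #T + 1 ∧ R ⊆ S) =
      Rᶜ.image (fun x => insert x R) := by
    ext S
    have := Finset.exists_eq_insert_iff (s := R) (t := S)
    simp only [mem_filter, mem_univ, true_and, mem_image, mem_compl]
    rw [this, hcard, and_comm, eq_comm]
  have hinj : Set.InjOn (fun x => insert x R) (Rᶜ : Finset α) := by
    intro x hx y _ hxy
    have hx' : x ∉ R := by simpa using hx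
    exact (Finset.insert_inj hx').1 hxy
  have hsub : T \ R ⊆ Rᶜ := fun x hx => by
    simpa using (mem_sdiff.1 hx).2
  have hcompl : #Rᶜ = #Tᶜ := by rw [card_compl, card_compl, hcard]
  have hle : #(T \ R) ≤ #T := card_le_card sdiff_subset
  rw [himage, sum_image hinj, ← sum_sdiff hsub]
  have h₁ : ∀ x ∈ Rᶜ \ (T \ R),
      inclusionInvCoeff #Tᶜ #(T \ insert x R) = inclusionInvCoeff #Tᶜ #(T \ R) := by
    intro x hx
    congr 2
    ext y
    simp only [mem_sdiff, mem_compl, mem_insert] at hx ⊢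
    grind
  have h₂ : ∀ x ∈ T \ R,
      inclusionInvCoeff #Tᶜ #(T \ insert x R) = inclusionInvCoeff #Tᶜ (#(T \ R) - 1) := by
    intro x hx
    rw [← card_erase_of_mem hx]
    congr 2
    ext y
    simp only [mem_sdiff, mem_erase, mem_insert]
    grind
  rw [sum_congr rfl h₁, sum_congr rfl h₂, sum_const, sum_const, card_sdiff_of_subset hsub, hcompl]
  by_cases hRT : R = T
  · subst hRT
    have : (#Rᶜ : ℂ) ≠ 0 := by
      exact_mod_cast (by omega : #Rᶜ ≠ 0)
    simp [inclusionInvCoeff, this]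
  · obtain ⟨t, ht⟩ : ∃ t, #(T \ R) = t + 1 := by
      refine Nat.exists_eq_succ_of_ne_zero fun h => hRT ?_
      rw [card_eq_zero, sdiff_eq_empty_iff_subset] at h
      exact (eq_of_subset_of_card_le h hcard.le).symm
    have hne : (#Tᶜ : ℂ) - (t + 1 : ℕ) ≠ 0 := by
      rw [sub_ne_zero]
      exact_mod_cast (by omega : #Tᶜ ≠ t + 1)
    rw [if_neg hRT, ht, Nat.add_sub_cancel, nsmul_eq_mul, nsmul_eq_mul, Nat.cast_sub (by omega),
      inclusionInvCoeff, mul_div_cancel₀ _ hne]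
    ring

theorem sum_smul_signedSumInto (T : Finset α) (hT : #T < #Tᶜ) :
    ∑ S : Finset α with #S = #T + 1, inclusionInvCoeff #Tᶜ #(T \ S) • signedSumInto T S =
      ∑ w : Perm α with w • T = T, signedPerm w := by
  simp only [signedSumInto, smul_sum]
  simp only [sum_filter (s := (univ : Finset (Perm α)))]
  rw [sum_comm]
  refine sum_congr rfl fun w _ => ?_
  rw [← sum_filter, filter_filter, ← sum_smul,
    sum_inclusionInvCoeff T (w • T) (card_smul_finset w T) hT]
  split_ifs <;> simp

/-- The signed sum over a two-block Young subgroup factors as a product over its blocks. -/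
theorem sum_signedPerm_mul_sum_signedPerm (S : Finset α) :
    (∑ σ : Perm α with ∀ i ∈ S, σ i = i, signedPerm σ) *
        (∑ τ : Perm α with ∀ i ∉ S, τ i = i, signedPerm τ) =
      ∑ w : Perm α with w • S = S, signedPerm w := by
  rw [sum_mul_sum, ← sum_product']
  refine sum_bij (fun p _ => p.1 * p.2) ?_ ?_ ?_ ?_
  · rintro ⟨σ, τ⟩ h
    simp only [mem_product, mem_filter, mem_univ, true_and] at h ⊢
    rw [mul_smul, smul_eq_of_fixes_compl h.2, smul_eq_of_fixes h.1]
  · rintro ⟨σ, τ⟩ h ⟨σ', τ'⟩ h' heq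
    simp only [mem_product, mem_filter, mem_univ, true_and] at h h' heq
    have hmem : ∀ {ρ : Perm α}, (∀ i ∉ S, ρ i = i) → ∀ i ∈ S, ρ i ∈ S := fun {ρ} hρ i hi => by
      have := smul_mem_smul_finset (a := ρ) hi
      rwa [smul_eq_of_fixes_compl hρ] at this
    have hτ : τ = τ' := by
      ext i
      by_cases hi : i ∈ S
      · have := Equiv.congr_fun heq i
        simp only [Perm.mul_apply] at this
        rwa [h.1 _ (hmem h.2 i hi), h'.1 _ (hmem h'.2 i hi)] at this
      · rw [h.2 i hi, h'.2 i hi]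
    subst hτ
    rw [mul_right_cancel heq]
  · intro w hw
    have hw' : ∀ x, w x ∈ S ↔ x ∈ S := fun x => by
      have := smul_mem_smul_finset_iff (s := S) (b := x) w
      rw [(mem_filter.1 hw).2] at this
      exact this
    have hτ : ∀ i ∉ S, Perm.ofSubtype (w.subtypePerm hw') i = i := fun i hi =>
      Perm.ofSubtype_apply_of_not_mem _ hi
    refine ⟨(w * (Perm.ofSubtype (w.subtypePerm hw'))⁻¹, Perm.ofSubtype (w.subtypePerm hw')),
      ?_, by simp⟩
    simp only [mem_product, mem_filter, mem_univ, true_and]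
    refine ⟨fun i hi => ?_, hτ⟩
    obtain ⟨j, rfl⟩ := (Perm.ofSubtype (w.subtypePerm hw')).surjective i
    by_cases hj : j ∈ S
    · rw [Perm.mul_apply, Perm.inv_def, symm_apply_apply, Perm.ofSubtype_apply_of_mem _ hj]
      rfl
    · exact absurd (hτ j hj ▸ hi) hj
  · rintro ⟨σ, τ⟩ _
    rw [signedPerm_mul]

/-- The signed sum over the stabilizer of `T` lies in every two-sided ideal containing that over
the stabilizer of a set with one more element, as long as `T` is smaller than its complement. -/
theorem sum_stabilizer_signedPerm_mem (I : TwoSidedIdeal (MonoidAlgebra ℂ (Perm α)))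
    {T S : Finset α} (hS : #S = #T + 1) (hT : #T < #Tᶜ)
    (hI : ∑ w : Perm α with w • S = S, signedPerm w ∈ I) :
    ∑ w : Perm α with w • T = T, signedPerm w ∈ I := by
  have hsmul : ∀ (c : ℂ) {x : MonoidAlgebra ℂ (Perm α)}, x ∈ I → c • x ∈ I := fun c x hx => by
    rw [← smul_one_mul]
    exact I.mul_mem_left _ _ hx
  have hbase : signedSumInto T S ∈ I := by
    set H := univ.filter fun w : Perm α => w • S = S
    have hne : (#H : ℂ) ≠ 0 := by
      exact_mod_cast (card_pos.2 ⟨1, by simp [H]⟩).ne'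
    rw [← inv_smul_smul₀ hne (signedSumInto T S),
      ← sum_signedPerm_mul_signedSumInto T S H fun h hh => (mem_filter.1 hh).2]
    exact hsmul _ (I.mul_mem_right _ _ hI)
  rw [← sum_smul_signedSumInto T hT]
  refine sum_mem fun S' hS' => hsmul _ ?_
  obtain ⟨g, rfl⟩ := exists_perm_smul_eq (hS.trans (mem_filter.1 hS').2.symm)
  rw [← signedPerm_mul_signedSumInto]
  exact I.mul_mem_left _ _ hbase

end SignedSums

theorem Fkelt_eq_sum_stabilizer (m k : ℕ) :
    Fkelt m k = ∑ w : Perm (Fin (m + 1)) with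
      w • (univ.filter fun i : Fin (m + 1) => m + 1 - k ≤ i.val) =
        univ.filter fun i : Fin (m + 1) => m + 1 - k ≤ i.val, signedPerm w := by
  rw [← sum_signedPerm_mul_sum_signedPerm]
  simp only [Fkelt, signedPerm, mem_filter, mem_univ, true_and, not_le]

theorem card_filter_sub_le {n k : ℕ} (hk : k ≤ n) :
    #(univ.filter fun i : Fin n => n - k ≤ i.val) = k := by
  have h := card_filter_add_card_filter_not (s := (univ : Finset (Fin n))) (fun i => i.val < n - k)
  simp only [not_lt, Fin.card_filter_val_lt, card_univ, Fintype.card_fin] at h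
  omega

/-- For `m ≥ 1` and `0 ≤ k`, `k+1 ≤ ⌊(m+1)/2⌋`: the two-sided ideal of
`ℂ[S_{m+1}]` generated by `F_k` is contained in the two-sided ideal generated by `F_{k+1}`. -/
theorem stmt12 (m k : ℕ) (hm : 1 ≤ m) (hk : k + 1 ≤ (m+1)/2) :
    TwoSidedIdeal.span {Fkelt m k} ≤ TwoSidedIdeal.span {Fkelt m (k+1)} := by
  rw [TwoSidedIdeal.span_le, Set.singleton_subset_iff, SetLike.mem_coe, Fkelt_eq_sum_stabilizer m k]
  refine sum_stabilizer_signedPerm_mem _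
    (S := univ.filter fun i : Fin (m + 1) => m + 1 - (k + 1) ≤ i.val) ?_ ?_ ?_
  · rw [card_filter_sub_le (by omega), card_filter_sub_le (by omega)]
  · rw [card_compl, card_filter_sub_le (by omega), Fintype.card_fin]
    omega
  · rw [← Fkelt_eq_sum_stabilizer]
    exact TwoSidedIdeal.subset_span rfl
end

section
/- Let m ≥ 1 and r = m+1. Then the kernel of the linear map Θ_m has dimension (2m+2)!/((m+1)!·(m+2)!), the (m+1)-st Catalan number. -/
open scoped BigOperators

/-- The linear map `Θ_m : ℂ[M(2r)] → (2r-multilinear forms on ℂ^m)`, `M ↦ φ_M`. -/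
noncomputable def ThetaO (m r : ℕ) :
    (PM (2*r) →₀ ℂ) →ₗ[ℂ] ((Fin (2*r) → Fin m → ℂ) → ℂ) :=
  Finsupp.linearCombination ℂ (phiO m r)

namespace PM

open Finset

variable {N : ℕ}

theorem apply_apply (M : PM N) (i : Fin N) : M.1 (M.1 i) = i := M.2.1 i

theorem apply_ne (M : PM N) (i : Fin N) : M.1 i ≠ i := M.2.2 i

/-- The set of left endpoints of the blocks of a perfect matching. -/
def openers (M : PM N) : Finset (Fin N) := univ.filter fun i => i < M.1 i

theorem mem_openers {M : PM N} {i : Fin N} : i ∈ M.openers ↔ i < M.1 i := by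
  simp [openers]

/-- Every block of `M` has exactly one endpoint in `A`. -/
def Splits (M : PM N) (A : Finset (Fin N)) : Prop := ∀ i, M.1 i ∈ A ↔ i ∉ A

theorem splits_openers (M : PM N) : M.Splits M.openers := by
  intro i
  rw [mem_openers, mem_openers, M.apply_apply, not_lt]
  exact ⟨le_of_lt, fun h => lt_of_le_of_ne h (M.apply_ne i)⟩

theorem apply_mem_openers {M : PM N} {i : Fin N} : M.1 i ∈ M.openers ↔ i ∉ M.openers :=
  M.splits_openers i

/-- A perfect matching is nonnesting if no block lies strictly between the endpoints of another. -/
def Nonnesting (M : PM N) : Prop :=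
  ∀ i ∈ M.openers, ∀ j ∈ M.openers, i < j → M.1 i < M.1 j

/-- The conjugate of a perfect matching by a permutation. -/
def conj (M : PM N) (π : Equiv.Perm (Fin N)) : PM N :=
  ⟨π⁻¹ * M.1 * π, by simp [M.apply_apply], fun i h => M.apply_ne (π i) 
    (Equiv.Perm.inv_eq_iff_eq.1 h)⟩

theorem conj_apply (M : PM N) (π : Equiv.Perm (Fin N)) (i : Fin N) :
    (M.conj π).1 i = π⁻¹ (M.1 (π i)) := rfl

/-- A product over the blocks of `M` can be computed over any set of representatives `A`. -/
@[to_additive]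
theorem prod_openers_eq {β : Type*} [CommMonoid β] {M : PM N} {A : Finset (Fin N)}
    (h : M.Splits A) (g : Fin N → β) :
    ∏ i ∈ M.openers, g (if i ∈ A then i else M.1 i) = ∏ i ∈ A, g i := by
  have hO := M.splits_openers
  refine prod_nbij' (fun i => if i ∈ A then i else M.1 i)
    (fun i => if i ∈ M.openers then i else M.1 i) ?_ ?_ ?_ ?_ ?_
  · intro i _
    split_ifs with hi
    exacts [hi, (h i).2 hi]
  · intro i _
    split_ifs with hi
    exacts [hi, (hO i).2 hi]
  · intro i hi
    by_cases hA : i ∈ A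
    · simp [hA, hi]
    · have := (hO i).not.2 (not_not.2 hi)
      simp [hA, this, M.apply_apply]
  · intro i hi
    by_cases hA : i ∈ M.openers
    · simp [hA, hi]
    · have := (h i).not.2 (not_not.2 hi)
      simp [hA, this, M.apply_apply]
  · simp

theorem card_openers_s15 {r : ℕ} (M : PM (2 * r)) : #M.openers = r := by
  have h : #M.openers = #M.openersᶜ :=
    card_nbij' M.1 M.1 (fun i hi => by
      have := (M.splits_openers i).not.2 (not_not.2 hi); simpa using this)
      (fun i hi => (M.splits_openers i).2 (by simpa using hi))
      (fun i _ => M.apply_apply i) (fun i _ => M.apply_apply i)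
  have := card_add_card_compl M.openers
  rw [Fintype.card_fin] at this
  omega

/-- The sum of the left endpoints is minimal among the sets of block representatives. -/
theorem eq_openers_of_sum_le {M : PM N} {A : Finset (Fin N)} (h : M.Splits A)
    (hle : ∑ i ∈ A, (i : ℕ) ≤ ∑ i ∈ M.openers, (i : ℕ)) : A = M.openers := by
  rw [← sum_openers_eq h (fun i => (i : ℕ))] at hle
  have hmono : ∀ i ∈ M.openers, (i : ℕ) ≤ ((if i ∈ A then i else M.1 i : Fin N) : ℕ) := by
    intro i hi
    split_ifs
    exacts [le_rfl, le_of_lt (mem_openers.1 hi)]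
  have heq := (sum_eq_sum_iff_of_le hmono).1 (le_antisymm (sum_le_sum hmono) hle)
  have hsub : ∀ i ∈ M.openers, i ∈ A := by
    intro i hi
    by_contra hA
    have := heq i hi
    rw [if_neg hA] at this
    exact M.apply_ne i (Fin.ext this.symm)
  ext i
  refine ⟨fun hi => ?_, hsub i⟩
  by_contra hO
  exact (h i).1 (hsub _ ((M.splits_openers i).2 hO)) hi

theorem not_lt_of_agree_below {M M' : PM N} (h' : M'.Nonnesting)
    (ho : M.openers = M'.openers) {a : Fin N} (ha : a ∈ M.openers)
    (ih : ∀ b < a, b ∈ M.openers → M.1 b = M'.1 b) : ¬ M.1 a < M'.1 a := by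
  intro hlt
  have hc : M'.1 (M.1 a) ∈ M'.openers := by
    rw [apply_mem_openers, ← ho, apply_mem_openers]
    simpa using ha
  rcases lt_trichotomy (M'.1 (M.1 a)) a with hb | hb | hb
  · have h1 := ih _ hb (ho ▸ hc)
    rw [M'.apply_apply] at h1
    exact hb.ne (M.1.injective h1)
  · have := congrArg M'.1 hb
    rw [M'.apply_apply] at this
    exact hlt.ne this
  · have := h' a (ho ▸ ha) _ hc hb
    rw [M'.apply_apply] at this
    exact lt_asymm this hlt

/-- A nonnesting matching is determined by its left endpoints. -/
theorem Nonnesting.eq_of_openers_eq {M M' : PM N} (h : M.Nonnesting) (h' : M'.Nonnesting)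
    (ho : M.openers = M'.openers) : M = M' := by
  have key : ∀ a, a ∈ M.openers → M.1 a = M'.1 a := by
    intro a
    induction a using WellFoundedLT.induction with
    | ind a ih =>
      intro ha
      refine le_antisymm ?_ ?_
      · exact not_lt.1 (not_lt_of_agree_below h ho.symm (ho ▸ ha)
          fun b hb hbo => (ih b hb (ho ▸ hbo)).symm)
      · exact not_lt.1 (not_lt_of_agree_below h' ho ha ih)
  ext i : 2
  by_cases hi : i ∈ M.openers
  · exact key i hi
  · have := key _ (apply_mem_openers.2 hi)
    rw [M.apply_apply] at this
    rw [← M'.apply_apply (M.1 i), ← this]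

theorem eq_one_of_conj_eq {M : PM N} {A : Finset (Fin N)} (h : M.Splits A)
    {π : Equiv.Perm A} (hπ : M.conj (Equiv.Perm.ofSubtype π) = M) : π = 1 := by
  ext a : 2
  have h1 := congrArg (fun M' : PM N => M'.1 a) hπ
  simp only [conj_apply, Equiv.Perm.inv_eq_iff_eq] at h1
  have ha : M.1 a ∉ A := fun hm => (h a).1 hm a.2
  rw [Equiv.Perm.ofSubtype_apply_of_not_mem (p := (· ∈ A)) π ha] at h1
  simpa using M.1.injective h1

theorem Splits.conj {M : PM N} {A : Finset (Fin N)} (h : M.Splits A) (π : Equiv.Perm A) :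
    (M.conj (Equiv.Perm.ofSubtype π)).Splits A := by
  have hmem : ∀ i, Equiv.Perm.ofSubtype π i ∈ A ↔ i ∈ A := fun i =>
    Equiv.Perm.ofSubtype_apply_mem_iff_mem π i
  intro i
  rw [conj_apply, ← hmem, Equiv.Perm.inv_def, Equiv.apply_symm_apply, h, hmem]

/-- The signed sum of the matchings obtained from `M` by permuting its left endpoints. -/
noncomputable def alternating (M : PM N) : PM N →₀ ℂ :=
  ∑ π : Equiv.Perm M.openers,
    Finsupp.single (M.conj (Equiv.Perm.ofSubtype π)) ((Equiv.Perm.sign π : ℤ) : ℂ)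

theorem alternating_apply_self (M : PM N) : M.alternating M = 1 := by
  rw [alternating, Finsupp.finsetSum_apply, sum_eq_single 1]
  · rw [Finsupp.single_apply, if_pos]
    · simp
    · ext i : 2
      simp [conj_apply]
  · intro π _ hπ
    rw [Finsupp.single_apply, if_neg]
    exact fun h => hπ (eq_one_of_conj_eq M.splits_openers h)
  · simp

theorem splits_of_alternating_ne_zero {M M' : PM N} (h : M.alternating M' ≠ 0) :
    M'.Splits M.openers := by
  rw [alternating, Finsupp.finsetSum_apply] at h
  obtain ⟨π, -, hπ⟩ := exists_ne_zero_of_sum_ne_zero h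
  rw [Finsupp.single_apply] at hπ
  rw [← (ite_ne_right_iff.1 hπ).1]
  exact M.splits_openers.conj π

theorem dotC_comm (m : ℕ) (u w : Fin m → ℂ) : dotC m u w = dotC m w u := by
  simp [dotC, mul_comm]

theorem phiO_eq_prod {m r : ℕ} {M : PM (2 * r)} {A : Finset (Fin (2 * r))} (h : M.Splits A)
    (v : Fin (2 * r) → Fin m → ℂ) :
    phiO m r M v = ∏ i ∈ A, dotC m (v i) (v (M.1 i)) := by
  rw [← prod_openers_eq h]
  refine prod_congr rfl fun i _ => ?_
  split_ifs
  · rfl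
  · rw [M.apply_apply, dotC_comm]

theorem _root_.Matrix.det_mul_eq_zero_of_card_lt {n p K : Type*} [Fintype n] [DecidableEq n]
    [Fintype p] [Field K] (h : Fintype.card p < Fintype.card n) (X : Matrix n p K)
    (Y : Matrix p n K) : (X * Y).det = 0 := by
  by_contra hdet
  have h1 := Matrix.rank_of_isUnit (X * Y) ((Matrix.isUnit_iff_isUnit_det _).2 (Ne.isUnit hdet))
  have h2 := (Matrix.rank_mul_le_left X Y).trans X.rank_le_card_width
  omega

theorem alternating_mem_ker {m r : ℕ} (hmr : m < r) (M : PM (2 * r)) :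
    M.alternating ∈ LinearMap.ker (ThetaO m r) := by
  rw [LinearMap.mem_ker]
  ext v
  have hdet := Matrix.det_mul_eq_zero_of_card_lt (n := M.openers) (p := Fin m) (K := ℂ)
    (by simpa [card_openers_s15] using hmr)
    (Matrix.of fun b c => v (M.1 b) c) (Matrix.of fun c a => v a c)
  rw [Matrix.det_apply'] at hdet
  rw [Pi.zero_apply, ← hdet, alternating, map_sum, Finset.sum_apply]
  refine sum_congr rfl fun π _ => ?_
  rw [ThetaO, Finsupp.linearCombination_single, Pi.smul_apply,
    phiO_eq_prod (M.splits_openers.conj π), smul_eq_mul, ← prod_coe_sort]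
  congr 1
  refine prod_congr rfl fun a _ => ?_
  have hb : M.1 (π a) ∉ M.openers := fun hm => (M.splits_openers _).1 hm (π a).2
  have : (M.conj (Equiv.Perm.ofSubtype π)).1 a = M.1 (π a) := by
    rw [conj_apply, Equiv.Perm.inv_eq_iff_eq, Equiv.Perm.ofSubtype_apply_coe,
      Equiv.Perm.ofSubtype_apply_of_not_mem (p := (· ∈ M.openers)) π hb]
  rw [this, dotC_comm]
  rfl

theorem linearIndependent_alternating :
    LinearIndependent ℂ fun M : {M : PM N // M.Nonnesting} => M.1.alternating := by
  classical
  rw [Fintype.linearIndependent_iff]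
  intro c hc
  by_contra! hne
  obtain ⟨i, hi⟩ := hne
  obtain ⟨K, hK, hmax⟩ := exists_max_image (univ.filter fun M => c M ≠ 0)
    (fun M => ∑ j ∈ M.1.openers, (j : ℕ)) ⟨i, by simpa using hi⟩
  simp only [mem_filter, mem_univ, true_and] at hK hmax
  have h := DFunLike.congr_fun hc K.1
  rw [Finsupp.finsetSum_apply, sum_eq_single K] at h
  · simp [alternating_apply_self, hK] at h
  · intro M _ hMK
    by_contra hM
    rw [Finsupp.smul_apply, smul_eq_mul] at hM
    have hs := splits_of_alternating_ne_zero (right_ne_zero_of_mul hM)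
    have := eq_openers_of_sum_le hs (hmax M (left_ne_zero_of_mul hM))
    exact hMK (Subtype.ext (M.2.eq_of_openers_eq K.2 this))
  · simp

/-- The left endpoint of the block of `i`, with the left endpoint `b` replaced by `a`. -/
def mergedRep (M : PM N) (a b i : Fin N) : Fin N :=
  if (if i ∈ M.openers then i else M.1 i) = b then a else if i ∈ M.openers then i else M.1 i

theorem mergedRep_mem {M : PM N} {a b : Fin N} (ha : a ∈ M.openers) (hab : a ≠ b) (i : Fin N) :
    M.mergedRep a b i ∈ M.openers.erase b := by
  have := M.splits_openers i
  rw [mergedRep, mem_erase]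
  grind

/-- The sum `∑ i, i * M i`, which grows when nestings are resolved. -/
def potential (M : PM N) : ℕ := ∑ i : Fin N, (i : ℕ) * (M.1 i : ℕ)

theorem potential_lt_of_mergedRep {M M' : PM N} {a b : Fin N} (hab : a < b) (hb : b < M.1 b)
    (hba : M.1 b < M.1 a) (h : ∀ i, M.mergedRep a b (M'.1 i) = M.mergedRep a b i)
    (hne : M' ≠ M) : M.potential < M'.potential := by
  set c := M.1 b with hc
  set d := M.1 a with hd
  have hcb : M.1 c = b := M.apply_apply b
  have hda : M.1 d = a := M.apply_apply a
  have haO : a ∈ M.openers := mem_openers.2 (by rw [← hd]; order)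
  have hbO : b ∈ M.openers := mem_openers.2 hb
  have hcO : c ∉ M.openers := by rw [hc, apply_mem_openers]; simpa using hbO
  have hdO : d ∉ M.openers := by rw [hd, apply_mem_openers]; simpa using haO
  let S : Finset (Fin N) := {a, b, c, d}
  have hS : ∀ i, i ∈ S ↔ i = a ∨ i = b ∨ i = c ∨ i = d := by simp [S]
  have hrep : ∀ i, M.mergedRep a b i = a ↔ i ∈ S := by
    intro i
    have := M.apply_apply i
    rw [mergedRep, hS]
    grind
  have hout : ∀ i, i ∉ S → M'.1 i = M.1 i := by
    intro i hi
    have h1 := h i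
    have h2 := (hrep i).not.2 hi
    have h3 := M'.apply_ne i
    have h4 := M.apply_apply i
    have h5 := M.apply_apply (M'.1 i)
    unfold mergedRep at h1 h2
    grind
  have hin : ∀ i ∈ S, M'.1 i ∈ S := fun i hi => by rw [← hrep, h, hrep]; exact hi
  have hsum : ∀ K : PM N, K.potential = (a * K.1 a + (b * K.1 b + (c * K.1 c + d * K.1 d))) +
      ∑ i ∈ Sᶜ, ((i : Fin N) : ℕ) * (K.1 i : ℕ) := by
    intro K
    rw [potential, ← sum_add_sum_compl S]
    congr 1
    rw [sum_insert, sum_insert, sum_insert, sum_singleton]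
    · simp; order
    · simp; constructor <;> order
    · simp; refine ⟨?_, ?_, ?_⟩ <;> order
  have hcompl : ∑ i ∈ Sᶜ, ((i : Fin N) : ℕ) * (M'.1 i : ℕ) = ∑ i ∈ Sᶜ, (i : ℕ) * (M.1 i : ℕ) :=
    sum_congr rfl fun i hi => by rw [hout i (mem_compl.1 hi)]
  rw [hsum, hsum M', hcompl, ← hc, ← hd, hcb, hda]
  have h1 := hin a (by simp [S])
  have h2 := hin b (by simp [S])
  have h3 := hin c (by simp [S])
  rw [hS] at h1 h2 h3
  have ia := M'.apply_apply a
  have ib := M'.apply_apply b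
  have ic := M'.apply_apply c
  have na := M'.apply_ne a
  have nb := M'.apply_ne b
  have nc := M'.apply_ne c
  have hab' : (a : ℕ) < b := hab
  have hbc' : (b : ℕ) < c := hb
  have hcd' : (c : ℕ) < d := hba
  rcases h1 with h1 | h1 | h1 | h1
  · exact absurd h1 na
  · have hcd : M'.1 c = d := by grind
    have hdc : M'.1 d = c := by rw [← hcd, M'.apply_apply]
    have hb' : M'.1 b = a := by rw [← h1, M'.apply_apply]
    rw [h1, hb', hcd, hdc]
    nlinarith
  · have hbd : M'.1 b = d := by grind
    have hdb : M'.1 d = b := by rw [← hbd, M'.apply_apply]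
    have hc' : M'.1 c = a := by rw [← h1, M'.apply_apply]
    rw [h1, hbd, hdb, hc']
    nlinarith
  · refine absurd ?_ hne
    have hbc : M'.1 b = c := by grind
    ext i : 2
    by_cases hi : i ∈ S
    · rw [hS] at hi
      have := M'.apply_apply d
      grind
    · exact hout i hi

theorem phiO_single {m r : ℕ} (M : PM (2 * r)) (f : Fin (2 * r) → Fin m) :
    phiO m r M (fun i => Pi.single (f i) 1) = if ∀ i, f (M.1 i) = f i then 1 else 0 := by
  have hdot : ∀ a b : Fin m, dotC m (Pi.single a 1) (Pi.single b 1) = if b = a then 1 else 0 := by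
    intro a b
    simp [dotC, Pi.single_apply, eq_comm]
  simp_rw [phiO_eq_prod M.splits_openers, hdot, prod_ite_zero, prod_const_one]
  refine if_congr ⟨fun h i => ?_, fun h i _ => h i⟩ rfl rfl
  by_cases hi : i ∈ M.openers
  · exact h i hi
  · have := h _ (apply_mem_openers.2 hi)
    rw [M.apply_apply] at this
    exact this.symm

theorem eq_zero_of_mem_ker {m : ℕ} {x : PM (2 * (m + 1)) →₀ ℂ}
    (hx : x ∈ LinearMap.ker (ThetaO m (m + 1)))
    (h : ∀ M : PM (2 * (m + 1)), M.Nonnesting → x M = 0) : x = 0 := by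
  classical
  by_contra hx0
  obtain ⟨M, hM, hmax⟩ := exists_max_image x.support potential (Finsupp.support_nonempty_iff.2 hx0)
  have hn : ¬ M.Nonnesting := fun hn => Finsupp.mem_support_iff.1 hM (h M hn)
  simp only [Nonnesting, not_forall, not_lt] at hn
  obtain ⟨a, ha, b, hb, hab, hle⟩ := hn
  have hlt : M.1 b < M.1 a := lt_of_le_of_ne hle fun he => hab.ne (M.1.injective he.symm)
  have hcard : #(M.openers.erase b) = m := by rw [card_erase_of_mem hb, card_openers_s15]; rfl
  let f : Fin (2 * (m + 1)) → Fin m := fun i =>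
    equivFinOfCardEq hcard ⟨M.mergedRep a b i, mergedRep_mem ha hab.ne i⟩
  have hf : ∀ i j, f i = f j ↔ M.mergedRep a b i = M.mergedRep a b j := by
    intro i j
    simp [f]
  have hker := congrFun (LinearMap.mem_ker.1 hx) fun i => Pi.single (f i) 1
  rw [ThetaO, Finsupp.linearCombination_apply, Finsupp.sum, Finset.sum_apply, sum_eq_single M] at hker
  · rw [Pi.smul_apply, phiO_single, if_pos] at hker
    · exact Finsupp.mem_support_iff.1 hM (by simpa using hker)
    · intro i
      have hO := M.splits_openers i
      have := M.apply_apply i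
      rw [hf, mergedRep, mergedRep]
      grind
  · intro M' hM' hne
    rw [Pi.smul_apply, phiO_single, if_neg, smul_zero]
    intro hcol
    exact (hmax M' hM').not_gt
      (potential_lt_of_mergedRep hab (mem_openers.1 hb) hlt (fun i => (hf _ _).1 (hcol i)) hne)
  · exact fun hM' => absurd hM hM'

open Classical in
theorem finrank_ker_eq_card (m : ℕ) :
    Module.finrank ℂ (LinearMap.ker (ThetaO m (m + 1))) =
      Fintype.card {M : PM (2 * (m + 1)) // M.Nonnesting} := by
  apply le_antisymm
  · let e : LinearMap.ker (ThetaO m (m + 1)) →ₗ[ℂ]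
        ({M : PM (2 * (m + 1)) // M.Nonnesting} → ℂ) :=
      LinearMap.pi (fun M => Finsupp.lapply M.1) ∘ₗ Submodule.subtype _
    have he : Function.Injective e := by
      rw [injective_iff_map_eq_zero]
      intro x hx
      exact Subtype.ext (eq_zero_of_mem_ker x.2 fun M hM => congrFun hx ⟨M, hM⟩)
    simpa using LinearMap.finrank_le_finrank_of_injective he
  · refine LinearIndependent.fintype_card_le_finrank
      (b := fun M : {M : PM (2 * (m + 1)) // M.Nonnesting} =>
        (⟨M.1.alternating, alternating_mem_ker (Nat.lt_succ_self m) M.1⟩ :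
          LinearMap.ker (ThetaO m (m + 1)))) ?_
    exact LinearIndependent.of_comp (Submodule.subtype _) linearIndependent_alternating

theorem exists_nonnesting_openers_eq {r : ℕ} {A : Finset (Fin (2 * r))} (hA : #A = r)
    (hbal : ∀ k : ℕ, #{i : Fin (2 * r) | (i : ℕ) < k ∧ i ∉ A} ≤
      #{i : Fin (2 * r) | (i : ℕ) < k ∧ i ∈ A}) :
    ∃ M : PM (2 * r), M.Nonnesting ∧ M.openers = A := by
  have hAc : #Aᶜ = r := by rw [card_compl, hA, Fintype.card_fin]; omega
  let a := A.orderEmbOfFin hA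
  let b := Aᶜ.orderEmbOfFin hAc
  have ha : ∀ i, a i ∈ A := A.orderEmbOfFin_mem hA
  have hb : ∀ i, b i ∉ A := fun i => mem_compl.1 (Aᶜ.orderEmbOfFin_mem hAc i)
  let e := finSumEquivOfFinset hA hAc
  have hel : ∀ i, e (Sum.inl i) = a i := fun i => finSumEquivOfFinset_inl hA hAc i
  have her : ∀ i, e (Sum.inr i) = b i := fun i => finSumEquivOfFinset_inr hA hAc i
  have hcases : ∀ i, (∃ k, i = a k) ∨ ∃ k, i = b k := by
    intro i
    obtain ⟨s | s, rfl⟩ := e.surjective i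
    exacts [Or.inl ⟨s, hel s⟩, Or.inr ⟨s, her s⟩]
  have hlt : ∀ i, a i < b i := by
    intro i
    by_contra hle
    have h1 : #((Iic i).image b) ≤ #{j : Fin (2 * r) | (j : ℕ) < b i + 1 ∧ j ∉ A} := by
      refine card_le_card fun j hj => ?_
      obtain ⟨l, hl, rfl⟩ := mem_image.1 hj
      have : b l ≤ b i := b.monotone (mem_Iic.1 hl)
      simp only [mem_filter, mem_univ, true_and]
      exact ⟨Nat.lt_succ_of_le this, hb l⟩
    have h2 : #{j : Fin (2 * r) | (j : ℕ) < b i + 1 ∧ j ∈ A} ≤ #((Iio i).image a) := by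
      refine card_le_card fun j hj => ?_
      simp only [mem_filter, mem_univ, true_and] at hj
      obtain ⟨l, rfl⟩ | ⟨l, rfl⟩ := hcases j
      · have h3 : a l ≤ b i := Nat.le_of_lt_succ hj.1
        have h4 : b i ≠ a i := fun h => hb i (h ▸ ha i)
        have h5 : a l < a i := by order
        exact mem_image_of_mem _ (mem_Iio.2 (a.lt_iff_lt.1 h5))
      · exact absurd hj.2 (hb l)
    have h3 := hbal (b i + 1)
    rw [card_image_of_injective _ a.injective, Fin.card_Iio] at h2
    rw [card_image_of_injective _ b.injective, Fin.card_Iic] at h1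
    omega
  let σ : Equiv.Perm (Fin (2 * r)) := (e.symm.trans (Equiv.sumComm _ _)).trans e
  have hσa : ∀ k, σ (a k) = b k := fun k => by simp [σ, ← hel, ← her]
  have hσb : ∀ k, σ (b k) = a k := fun k => by simp [σ, ← hel, ← her]
  let M : PM (2 * r) := ⟨σ, fun i => by
    obtain ⟨k, rfl⟩ | ⟨k, rfl⟩ := hcases i
    · rw [hσa, hσb]
    · rw [hσb, hσa], fun i => by
    obtain ⟨k, rfl⟩ | ⟨k, rfl⟩ := hcases i
    · rw [hσa]; exact (hlt k).ne'
    · rw [hσb]; exact (hlt k).ne⟩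
  have hM : M.openers = A := by
    ext i
    rw [mem_openers]
    obtain ⟨k, rfl⟩ | ⟨k, rfl⟩ := hcases i
    · change a k < σ (a k) ↔ _
      simp [hσa, hlt, ha]
    · change b k < σ (b k) ↔ _
      simp [hσb, (hlt k).le, hb]
  refine ⟨M, ?_, hM⟩
  rw [Nonnesting, hM]
  intro i hi j hj hij
  obtain ⟨k, rfl⟩ | ⟨k, rfl⟩ := hcases i
  · obtain ⟨l, rfl⟩ | ⟨l, rfl⟩ := hcases j
    · change σ (a k) < σ (a l)
      rw [hσa, hσa]
      exact b.lt_iff_lt.2 (a.lt_iff_lt.1 hij)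
    · exact absurd hj (hb l)
  · exact absurd hi (hb k)

theorem _root_.List.count_take_ofFn {α : Type*} [DecidableEq α] {n : ℕ} (f : Fin n → α) (x : α)
    (k : ℕ) : ((List.ofFn f).take k).count x = #{i : Fin n | (i : ℕ) < k ∧ f i = x} := by
  induction k with
  | zero => simp
  | succ k ih =>
    rw [List.take_add_one, List.count_append, ih, List.getElem?_ofFn]
    split_ifs with hk
    · have hsplit : univ.filter (fun i : Fin n => (i : ℕ) < k + 1 ∧ f i = x) =
          univ.filter (fun i : Fin n => (i : ℕ) < k ∧ f i = x) ∪
            univ.filter (fun i : Fin n => i = ⟨k, hk⟩ ∧ f i = x) := by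
        ext i
        simp only [mem_union, mem_filter, mem_univ, true_and, Fin.ext_iff]
        grind
      rw [hsplit, card_union_of_disjoint]
      · congr 1
        rw [← filter_filter, filter_eq' univ]
        simp [filter_singleton, List.count_singleton']
        split_ifs <;> simp
      · rw [disjoint_filter]
        rintro i - ⟨h, -⟩ ⟨rfl, -⟩
        exact lt_irrefl _ h
    · simp only [Option.toList_none, List.count_nil, add_zero]
      congr 1
      ext i
      have := i.2
      grind

/-- The sequence recording whether each point is a left or a right endpoint. -/
def steps (M : PM N) (i : Fin N) : DyckStep := if i ∈ M.openers then .U else .D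

theorem steps_eq_U {M : PM N} {i : Fin N} : M.steps i = .U ↔ i ∈ M.openers := by
  simp [steps]

theorem steps_eq_D {M : PM N} {i : Fin N} : M.steps i = .D ↔ i ∉ M.openers := by
  simp [steps]

theorem count_U_steps {r : ℕ} (M : PM (2 * r)) : (List.ofFn M.steps).count .U = r := by
  rw [← List.take_of_length_le (l := List.ofFn M.steps) (List.length_ofFn).le,
    List.count_take_ofFn]
  simp [steps_eq_U, card_openers_s15]

theorem count_D_steps {r : ℕ} (M : PM (2 * r)) : (List.ofFn M.steps).count .D = r := by
  rw [← List.take_of_length_le (l := List.ofFn M.steps) (List.length_ofFn).le,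
    List.count_take_ofFn]
  have := card_compl M.openers
  rw [card_openers_s15, Fintype.card_fin, compl_eq_univ_sdiff, sdiff_eq_filter] at this
  simp only [Fin.is_lt, true_and, steps_eq_D]
  omega

/-- The Dyck word of a perfect matching. -/
def toDyckWord {r : ℕ} (M : PM (2 * r)) : DyckWord where
  toList := List.ofFn M.steps
  count_U_eq_count_D := by rw [count_U_steps, count_D_steps]
  count_D_le_count_U k := by
    simp only [List.count_take_ofFn, steps_eq_U, steps_eq_D]
    refine card_le_card_of_injOn M.1 (fun i hi => ?_) M.1.injective.injOn
    simp only [coe_filter, mem_univ, true_and, Set.mem_ofPred_eq] at hi ⊢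
    have hO := apply_mem_openers.2 hi.2
    have hlt := mem_openers.1 hO
    rw [M.apply_apply] at hlt
    exact ⟨lt_trans hlt hi.1, hO⟩

theorem semilength_toDyckWord {r : ℕ} (M : PM (2 * r)) : M.toDyckWord.semilength = r :=
  M.count_U_steps

open Classical in
theorem card_nonnesting (r : ℕ) :
    Fintype.card {M : PM (2 * r) // M.Nonnesting} = catalan r := by
  rw [← DyckWord.card_dyckWord_semilength_eq_catalan]
  refine Fintype.card_of_bijective
    (f := fun M => ⟨M.1.toDyckWord, M.1.semilength_toDyckWord⟩) ⟨fun M M' h => ?_, fun w => ?_⟩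
  · have hs : M.1.steps = M'.1.steps :=
      List.ofFn_injective (congrArg (fun w => w.1.toList) h)
    refine Subtype.ext (M.2.eq_of_openers_eq M'.2 ?_)
    ext i
    rw [← steps_eq_U, ← steps_eq_U, hs]
  · obtain ⟨w, hw⟩ := w
    have hlen : w.toList.length = 2 * r := by rw [← hw, DyckWord.two_mul_semilength_eq_length]
    let f : Fin (2 * r) → DyckStep := fun i => w.toList[i]
    have hf : List.ofFn f = w.toList := by
      apply List.ext_getElem <;> simp [f, hlen]
    have hD : ∀ i, f i = .D ↔ i ∉ (univ.filter fun i => f i = .U) := by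
      intro i
      rcases (f i).dichotomy with h | h <;> simp [h]
    obtain ⟨M, hM, hO⟩ := exists_nonnesting_openers_eq (A := univ.filter fun i => f i = .U)
      (by
        have := List.count_take_ofFn f .U (2 * r)
        rw [hf, List.take_of_length_le hlen.le] at this
        simp only [Fin.is_lt, true_and] at this
        rw [← this]
        exact hw)
      (fun k => by
        have := w.count_D_le_count_U k
        rw [← hf, List.count_take_ofFn, List.count_take_ofFn] at this
        simp only [← hD]
        simpa using this)
    refine ⟨⟨M, hM⟩, Subtype.ext (DyckWord.ext ?_)⟩
    change List.ofFn M.steps = w.toList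
    rw [← hf]
    congr 1
    funext i
    rcases (f i).dichotomy with h | h <;> simp [steps, hO, h]

end PM

theorem catalan_eq_factorial_div (n : ℕ) :
    catalan n = (2 * n).factorial / (n.factorial * (n + 1).factorial) := by
  rw [catalan_eq_centralBinom_div, Nat.centralBinom_eq_two_mul_choose,
    Nat.choose_eq_factorial_div_factorial (by omega), Nat.div_div_eq_div_mul, Nat.factorial_succ]
  congr 1
  rw [show 2 * n - n = n by omega]
  ring

/-- For `m ≥ 1` and `r = m+1`, the kernel of `Θ_m` has dimension
`(2m+2)!/((m+1)!·(m+2)!)`, the `(m+1)`-st Catalan number. -/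
theorem stmt15 (m : ℕ) (hm : 1 ≤ m) :
    Module.finrank ℂ ↥(LinearMap.ker (ThetaO m (m+1))) =
      Nat.factorial (2*m+2) / (Nat.factorial (m+1) * Nat.factorial (m+2)) := by
  rw [PM.finrank_ker_eq_card, PM.card_nonnesting, catalan_eq_factorial_div]
  rfl
end
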